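/- arXiv:2601.21243 — 2 statements merged into one kernel-verified Lean document; each statement's English description precedes it below -/
import Mathlib

section
/- Consider the ZO-EG setting: f : 2^{[n]} × ℝ^m → ℝ is submodular in its first variable, concave and L_{0y}-Lipschitz in its second variable, f^L is its Lovász extension in the first variable, Y ⊂ ℝ^m is nonempty convex compact, Z = [0,1]^n × Y, z* = (x*, y*) is a saddle point of f^L on Z, and the subgradients used satisfy ‖g_x(z)‖ ≤ L₀ for all z ∈ Z. Fix step sizes h₁, h₂ > 0 and smoothing parameter μ > 0. For a current iterate z = (x,y) ∈ Z, sample u ∼ N(0, I_m), set G(z) = (g_x(z), −((f^L(x, y+μu) − f^L(x,y))/μ) u), let ẑ = Proj_Z(z − h₁ G(z)); then sample û ∼ N(0, I_m) independently, set G(ẑ) analogously using û, and let z⁺ = Proj_Z(z − h₂ G(ẑ)). Then E_{u,û}[f^L(x̂, y*) − f^L(x*, ŷ)] ≤ (‖z − z*‖² − E_{u,û}[‖z⁺ − z*‖²])/(2h₂) + μ L_{0y} m^{1/2} + (h₂/2 + h₁)(L₀² + L_{0y}²(m+4)²), where ẑ = (x̂, ŷ). -/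
open MeasureTheory Finset RealInnerProductSpace

/-- The standard Gaussian measure `N(0, I_m)` on `ℝ^m`, with density
`(2π)^{−m/2} e^{−‖u‖²/2}` with respect to the Lebesgue measure. -/
noncomputable def stdGaussian (m : ℕ) : Measure (EuclideanSpace ℝ (Fin m)) :=
  volume.withDensity fun u =>
    ENNReal.ofReal ((2 * Real.pi) ^ (-(m : ℝ) / 2) * Real.exp (-‖u‖ ^ 2 / 2))

/-- The hypercube `[0,1]^n ⊂ ℝ^n`. -/
def hypercube (n : ℕ) : Set (EuclideanSpace ℝ (Fin n)) :=
  {x | ∀ i, x i ∈ Set.Icc (0 : ℝ) 1}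

/-- The Lovász extension of `f : 2^{[n]} × ℝ^m → ℝ` in its first variable:
`f^L(x,y) = ∫₀¹ f(S_τ(x), y) dτ` where `S_τ(x) = {i : x_i > τ}`. -/
noncomputable def lovasz {n : ℕ} {α : Type*} (f : Finset (Fin n) → α → ℝ)
    (x : EuclideanSpace ℝ (Fin n)) (y : α) : ℝ :=
  ∫ τ in (0:ℝ)..1, f (Finset.univ.filter fun i => τ < x i) y

/-- The zeroth-order random oracle `((f^L(x, y+μu) − f^L(x,y))/μ) u` estimating the
gradient of the Gaussian smoothing of `f^L(x, ·)`. -/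
noncomputable def oracle {n m : ℕ} (f : Finset (Fin n) → EuclideanSpace ℝ (Fin m) → ℝ)
    (x : EuclideanSpace ℝ (Fin n)) (y : EuclideanSpace ℝ (Fin m)) (μ : ℝ)
    (u : EuclideanSpace ℝ (Fin m)) : EuclideanSpace ℝ (Fin m) :=
  ((lovasz f x (y + μ • u) - lovasz f x y) / μ) • u

/-- `q` is the Euclidean projection of `p` onto the set `C`. -/
def IsProjOn {E : Type*} [NormedAddCommGroup E] (C : Set E) (p q : E) : Prop :=
  q ∈ C ∧ ∀ w ∈ C, ‖p - q‖ ≤ ‖p - w‖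


section helpers

/-- Euclidean space abbreviation. -/
abbrev EE (m : ℕ) := EuclideanSpace ℝ (Fin m)

/-- Gaussian density. -/
noncomputable def gden (m : ℕ) (u : EE m) : ℝ :=
  (2 * Real.pi) ^ (-(m : ℝ) / 2) * Real.exp (-‖u‖ ^ 2 / 2)

lemma gden_nonneg (m : ℕ) (u : EE m) : 0 ≤ gden m u := by
  unfold gden; positivity

lemma gden_cont (m : ℕ) : Continuous (gden m) := by
  unfold gden; fun_prop

lemma stdG_integral (m : ℕ) (F : EE m → ℝ) :
    ∫ u, F u ∂(stdGaussian m) = ∫ u, gden m u * F u := by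
  unfold stdGaussian
  rw [integral_withDensity_eq_integral_toReal_smul]
  · refine integral_congr_ae (Filter.Eventually.of_forall fun u => ?_)
    have := gden_nonneg m u
    unfold gden at this ⊢
    simp only [smul_eq_mul]
    rw [ENNReal.toReal_ofReal this]
  · have := (gden_cont m).measurable.ennreal_ofReal
    unfold gden at this
    exact this
  · exact Filter.Eventually.of_forall fun u => ENNReal.ofReal_lt_top

lemma stdG_integrable (m : ℕ) (F : EE m → ℝ) :
    Integrable F (stdGaussian m) ↔ Integrable (fun u => gden m u * F u) := by
  unfold stdGaussian
  rw [integrable_withDensity_iff_integrable_smul']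
  · refine integrable_congr (Filter.Eventually.of_forall fun u => ?_)
    have := gden_nonneg m u
    unfold gden at this ⊢
    simp only [smul_eq_mul]
    rw [ENNReal.toReal_ofReal this]
  · have := (gden_cont m).measurable.ennreal_ofReal
    unfold gden at this
    exact this
  · exact Filter.Eventually.of_forall fun u => ENNReal.ofReal_lt_top

lemma int_exp_sq (m : ℕ) {b : ℝ} (hb : 0 < b) :
    Integrable (fun u : EE m => Real.exp (-b * ‖u‖ ^ 2)) := by
  have h := GaussianFourier.integrable_cexp_neg_mul_sq_norm_add (V := EE m) (b := (b : ℂ))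
    (by simpa using hb) 0 0
  refine h.norm.congr (Filter.Eventually.of_forall fun u => ?_)
  simp only [Complex.norm_exp]
  congr 1
  simp [← Complex.ofReal_pow]

/-- Continuous with at most exponential growth. -/
def EB {m : ℕ} (F : EE m → ℝ) : Prop :=
  Continuous F ∧ ∃ A c : ℝ, 0 ≤ A ∧ 0 ≤ c ∧ ∀ u, |F u| ≤ A * Real.exp (c * ‖u‖)

lemma EB.integrable {m : ℕ} {F : EE m → ℝ} (h : EB F) : Integrable F (stdGaussian m) := by
  obtain ⟨hc, A, c, hA, -, hb⟩ := h
  rw [stdG_integrable]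
  have h1 : Integrable (fun u : EE m => ((2 * Real.pi) ^ (-(m : ℝ) / 2) * A * Real.exp (c^2)) *
      Real.exp (-(1/4) * ‖u‖ ^ 2)) := (int_exp_sq m (by norm_num)).const_mul _
  refine h1.mono' ((gden_cont m).mul hc).aestronglyMeasurable
    (Filter.Eventually.of_forall fun u => ?_)
  rw [Real.norm_eq_abs, abs_mul, abs_of_nonneg (gden_nonneg m u)]
  have h2 : Real.exp (-‖u‖ ^ 2 / 2) * Real.exp (c * ‖u‖) ≤
      Real.exp (c^2) * Real.exp (-(1/4) * ‖u‖ ^ 2) := by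
    rw [← Real.exp_add, ← Real.exp_add]
    apply Real.exp_le_exp.2
    nlinarith [sq_nonneg (c - ‖u‖ / 2)]
  calc gden m u * |F u| ≤ gden m u * (A * Real.exp (c * ‖u‖)) :=
        mul_le_mul_of_nonneg_left (hb u) (gden_nonneg m u)
    _ = (2 * Real.pi) ^ (-(m : ℝ) / 2) * A * (Real.exp (-‖u‖ ^ 2 / 2) * Real.exp (c * ‖u‖)) := by
        unfold gden; ring
    _ ≤ (2 * Real.pi) ^ (-(m : ℝ) / 2) * A *
          (Real.exp (c^2) * Real.exp (-(1/4) * ‖u‖ ^ 2)) := by gcongr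
    _ = _ := by ring

lemma EB.const {m : ℕ} (a : ℝ) : EB (fun _ : EE m => a) :=
  ⟨continuous_const, |a|, 0, abs_nonneg _, le_rfl, fun u => by simp⟩

lemma EB.nrm {m : ℕ} : EB (fun u : EE m => ‖u‖) := by
  refine ⟨continuous_norm, 1, 1, by norm_num, by norm_num, fun u => ?_⟩
  rw [abs_of_nonneg (norm_nonneg u)]
  have := Real.add_one_le_exp ‖u‖
  simp only [one_mul]; linarith

lemma EB.expn {m : ℕ} (c : ℝ) : EB (fun u : EE m => Real.exp (c * ‖u‖)) := by
  refine ⟨by fun_prop, 1, |c|, by norm_num, abs_nonneg _, fun u => ?_⟩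
  rw [abs_of_nonneg (Real.exp_pos _).le, one_mul]
  apply Real.exp_le_exp.2
  exact mul_le_mul_of_nonneg_right (le_abs_self c) (norm_nonneg u)

lemma EB.mul {m : ℕ} {F G : EE m → ℝ} (hF : EB F) (hG : EB G) : EB (fun u => F u * G u) := by
  obtain ⟨h1, A, c, hA, hc, hb⟩ := hF
  obtain ⟨h1', A', c', hA', hc', hb'⟩ := hG
  refine ⟨h1.mul h1', A * A', c + c', by positivity, by positivity, fun u => ?_⟩
  rw [abs_mul, add_mul, Real.exp_add]
  calc |F u| * |G u| ≤ (A * Real.exp (c * ‖u‖)) * (A' * Real.exp (c' * ‖u‖)) :=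
        mul_le_mul (hb u) (hb' u) (abs_nonneg _) (by positivity)
    _ = _ := by ring

lemma EB.add {m : ℕ} {F G : EE m → ℝ} (hF : EB F) (hG : EB G) : EB (fun u => F u + G u) := by
  obtain ⟨h1, A, c, hA, hc, hb⟩ := hF
  obtain ⟨h1', A', c', hA', hc', hb'⟩ := hG
  refine ⟨h1.add h1', A + A', c + c', by positivity, by positivity, fun u => ?_⟩
  have e1 : Real.exp (c * ‖u‖) ≤ Real.exp ((c + c') * ‖u‖) :=
    Real.exp_le_exp.2 (by nlinarith [norm_nonneg u, mul_nonneg hc' (norm_nonneg u)])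
  have e2 : Real.exp (c' * ‖u‖) ≤ Real.exp ((c + c') * ‖u‖) :=
    Real.exp_le_exp.2 (by nlinarith [norm_nonneg u, mul_nonneg hc (norm_nonneg u)])
  calc |F u + G u| ≤ |F u| + |G u| := abs_add_le _ _
    _ ≤ A * Real.exp (c * ‖u‖) + A' * Real.exp (c' * ‖u‖) := add_le_add (hb u) (hb' u)
    _ ≤ A * Real.exp ((c + c') * ‖u‖) + A' * Real.exp ((c + c') * ‖u‖) := by gcongr
    _ = _ := by ring

lemma EB.sub {m : ℕ} {F G : EE m → ℝ} (hF : EB F) (hG : EB G) : EB (fun u => F u - G u) := by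
  have := hF.add ((EB.const (-1)).mul hG)
  convert this using 2 with u
  ring

lemma EB.of_le {m : ℕ} {F G : EE m → ℝ} (hG : EB G) (hF : Continuous F)
    (h : ∀ u, |F u| ≤ G u) : EB F := by
  obtain ⟨-, A, c, hA, hc, hb⟩ := hG
  exact ⟨hF, A, c, hA, hc, fun u => (h u).trans ((le_abs_self _).trans (hb u))⟩

lemma EB.abs {m : ℕ} {F : EE m → ℝ} (hF : EB F) : EB (fun u => |F u|) := by
  obtain ⟨h1, A, c, hA, hc, hb⟩ := hF
  exact ⟨h1.abs, A, c, hA, hc, fun u => by simpa using hb u⟩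

lemma EB.pow {m : ℕ} {F : EE m → ℝ} (hF : EB F) (k : ℕ) : EB (fun u => F u ^ k) := by
  induction k with
  | zero => simpa using EB.const (m := m) 1
  | succ k ih => simpa [pow_succ] using ih.mul hF

lemma EB.inner {m : ℕ} (w : EE m) : EB (fun u : EE m => ⟪u, w⟫) :=
  ((EB.nrm.mul (EB.const ‖w‖))).of_le (by fun_prop) fun u => abs_real_inner_le_norm u w

lemma EB.lip {m : ℕ} {F : EE m → ℝ} {K : ℝ}
    (h : ∀ u v, |F u - F v| ≤ K * ‖u - v‖) : EB F := by
  have hc : Continuous F := by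
    refine (LipschitzWith.of_dist_le_mul (K := K.toNNReal) fun u v => ?_).continuous
    rw [Real.dist_eq, dist_eq_norm]
    exact (h u v).trans (mul_le_mul_of_nonneg_right (Real.le_coe_toNNReal K) (norm_nonneg _))
  refine ((EB.const |F 0|).add ((EB.const K).mul EB.nrm)).of_le hc fun u => ?_
  have := h u 0
  rw [sub_zero] at this
  have h2 := abs_add_le (F u - F 0) (F 0)
  rw [sub_add_cancel] at h2
  linarith

lemma stdG_one (m : ℕ) : ∫ _u : EE m, (1 : ℝ) ∂(stdGaussian m) = 1 := by
  rw [stdG_integral]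
  simp only [mul_one]
  unfold gden
  rw [integral_const_mul]
  have := GaussianFourier.integral_rexp_neg_mul_sq_norm (V := EE m) (b := 1/2) (by norm_num)
  have e : ∀ u : EE m, -‖u‖ ^ 2 / 2 = -(1/2) * ‖u‖ ^ 2 := fun u => by ring
  simp_rw [e, this]
  rw [show Real.pi / (1/2) = 2 * Real.pi by ring, finrank_euclideanSpace_fin,
    ← Real.rpow_add (by positivity), neg_div, neg_add_cancel, Real.rpow_zero]

instance stdG_prob (m : ℕ) : IsProbabilityMeasure (stdGaussian m) := by
  have h1 : Integrable (fun _ : EE m => (1:ℝ)) (stdGaussian m) := (EB.const 1).integrable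
  have hf : IsFiniteMeasure (stdGaussian m) := by
    rw [integrable_const_iff] at h1
    simpa using h1
  have := stdG_one m
  simp only [integral_const, smul_eq_mul, mul_one] at this
  constructor
  rw [Measure.real, ENNReal.toReal_eq_one_iff] at this
  exact this

lemma stdG_moment (m k : ℕ) : ∫ u : EE m, ‖u‖ ^ (k + 2) ∂(stdGaussian m)
    = (m + k) * ∫ u : EE m, ‖u‖ ^ k ∂(stdGaussian m) := by
  rcases Nat.eq_zero_or_pos m with rfl | hm
  · have : ∀ u : EE 0, ‖u‖ = 0 := fun u => by rw [Subsingleton.elim u 0, norm_zero]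
    simp only [this]
    rcases Nat.eq_zero_or_pos k with rfl | hk
    · simp
    · simp [hk.ne']
  have : Nonempty (Fin m) := ⟨⟨0, hm⟩⟩
  have key : ∀ j : ℕ, ∫ u : EE m, ‖u‖ ^ j ∂(stdGaussian m) =
      (2 * Real.pi) ^ (-(m : ℝ) / 2) * (m * (volume.real (Metric.ball (0 : EE m) 1) *
      ((1/2 : ℝ) ^ (-((m + j : ℝ)) / 2) * (1 / 2) * Real.Gamma ((m + j) / 2)))) := by
    intro j
    rw [stdG_integral]
    unfold gden
    simp_rw [mul_assoc]
    rw [integral_const_mul]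
    congr 1
    rw [integral_fun_norm_addHaar (volume : Measure (EE m))
      (fun r => Real.exp (-r ^ 2 / 2) * r ^ j)]
    rw [nsmul_eq_mul, finrank_euclideanSpace_fin, smul_eq_mul]
    congr 2
    have h2 := integral_rpow_mul_exp_neg_mul_rpow (p := 2) (q := m + j - 1) (b := 1/2)
      (by norm_num) (by have : (0:ℝ) < m := by exact_mod_cast hm
                        have : (0:ℝ) ≤ j := by positivity
                        linarith) (by norm_num)
    rw [sub_add_cancel, mul_assoc] at h2
    rw [← h2]
    refine setIntegral_congr_fun measurableSet_Ioi fun r hr => ?_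
    have hr : (0:ℝ) < r := hr
    have e : (m + j - 1 : ℝ) = ((m - 1 + j : ℕ) : ℝ) := by
      push_cast [Nat.cast_sub hm]; ring
    simp only [smul_eq_mul]
    rw [e, Real.rpow_natCast, pow_add]
    rw [show (r ^ (2:ℝ)) = r ^ 2 by norm_cast]
    rw [show -r ^ 2 / 2 = -(1/2) * r ^ 2 by ring]
    ring
  rw [key, key]
  have hmk : (0 : ℝ) < m + k := by positivity
  have e1 : ((m : ℝ) + (k + 2 : ℕ)) / 2 = (m + k) / 2 + 1 := by push_cast; ring
  have e2 : -((m : ℝ) + (k + 2 : ℕ)) / 2 = -(m + k) / 2 + (-1) := by push_cast; ring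
  rw [e1, e2, Real.Gamma_add_one (by positivity), Real.rpow_add (by norm_num), Real.rpow_neg_one]
  ring

lemma stdG_m2 (m : ℕ) : ∫ u : EE m, ‖u‖ ^ 2 ∂(stdGaussian m) = m := by
  have := stdG_moment m 0
  simpa using this

lemma stdG_m4 (m : ℕ) : ∫ u : EE m, ‖u‖ ^ 4 ∂(stdGaussian m) = (m + 2) * m := by
  have := stdG_moment m 2
  rw [stdG_m2] at this
  simpa using this

lemma stdG_m1 (m : ℕ) : ∫ u : EE m, ‖u‖ ∂(stdGaussian m) ≤ Real.sqrt m := by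
  have h0 : 0 ≤ ∫ u : EE m, (‖u‖ - ∫ v : EE m, ‖v‖ ∂(stdGaussian m)) ^ 2 ∂(stdGaussian m) :=
    integral_nonneg fun u => sq_nonneg _
  set M := ∫ v : EE m, ‖v‖ ∂(stdGaussian m) with hM
  have e : ∀ u : EE m, (‖u‖ - M) ^ 2 = (‖u‖ ^ 2 - (2 * M) * ‖u‖) + M ^ 2 := fun u => by ring
  simp_rw [e] at h0
  rw [integral_add ((EB.nrm.pow 2).sub ((EB.const (2*M)).mul EB.nrm)).integrable
    (EB.const _).integrable, integral_sub (EB.nrm.pow 2).integrable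
    ((EB.const (2*M)).mul EB.nrm).integrable, integral_const_mul, stdG_m2, ← hM] at h0
  simp at h0
  apply Real.le_sqrt_of_sq_le
  nlinarith

lemma exp_second (x : ℝ) : |Real.exp x - 1 - x| ≤ x ^ 2 * Real.exp |x| := by
  have h1 := Real.add_one_le_exp x
  have h2 := Real.add_one_le_exp (-x)
  have hp := Real.exp_pos x
  have h3 : Real.exp x - 1 ≤ x * Real.exp x := by
    have : Real.exp (-x) * Real.exp x = 1 := by rw [← Real.exp_add]; simp
    nlinarith
  have h5 : 1 ≤ Real.exp |x| := Real.one_le_exp (abs_nonneg x)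
  rw [abs_of_nonneg (by linarith)]
  rcases le_total 0 x with hx | hx
  · rw [abs_of_nonneg hx] at *
    nlinarith
  · have h6 : Real.exp x - 1 - x ≤ x * (Real.exp x - 1) := by linarith
    have h7 : x * (Real.exp x - 1) ≤ x * x := by nlinarith
    nlinarith [sq_nonneg x]

lemma shift_int {m : ℕ} (ψ : EE m → ℝ) (w : EE m) :
    ∫ u, ψ (u + w) ∂(stdGaussian m)
      = ∫ u, ψ u * Real.exp (⟪u, w⟫ - ‖w‖ ^ 2 / 2) ∂(stdGaussian m) := by
  rw [stdG_integral, stdG_integral]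
  rw [← integral_add_right_eq_self (μ := (volume : Measure (EE m)))
    (fun u => gden m u * (ψ u * Real.exp (⟪u, w⟫ - ‖w‖ ^ 2 / 2))) w]
  refine integral_congr_ae (Filter.Eventually.of_forall fun u => ?_)
  unfold gden
  have : Real.exp (-‖u + w‖ ^ 2 / 2) * Real.exp (⟪u + w, w⟫ - ‖w‖ ^ 2 / 2)
      = Real.exp (-‖u‖ ^ 2 / 2) := by
    rw [← Real.exp_add]
    congr 1
    rw [norm_add_sq_real, inner_add_left, real_inner_self_eq_norm_sq]
    ring
  simp only
  rw [← this]
  ring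

set_option maxHeartbeats 400000 in
lemma smooth_ineq {m : ℕ} {ψ : EE m → ℝ} {K : ℝ}
    (hl : ∀ u v, |ψ u - ψ v| ≤ K * ‖u - v‖) (hc : ConcaveOn ℝ Set.univ ψ) (w : EE m) :
    ∫ u, ψ (u + w) ∂(stdGaussian m) - ∫ u, ψ u ∂(stdGaussian m)
      ≤ ∫ u, ψ u * ⟪u, w⟫ ∂(stdGaussian m) := by
  have hψ : EB ψ := EB.lip hl
  have hsh : ∀ v : EE m, EB (fun u => ψ (u + v)) := fun v =>
    EB.lip (K := K) fun a b => by simpa using hl (a + v) (b + v)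
  set W := ‖w‖ with hW
  set b := W ^ 2 / 2 with hb
  have hb0 : 0 ≤ b := by positivity
  have hQ : EB (fun u : EE m => |ψ u| * (b + (W * ‖u‖ + b) ^ 2 *
      (Real.exp (W * ‖u‖) * Real.exp b))) :=
    hψ.abs.mul ((EB.const b).add (((((EB.const W).mul EB.nrm).add (EB.const b)).pow 2).mul
      ((EB.expn W).mul (EB.const _))))
  set C := ∫ u : EE m, |ψ u| * (b + (W * ‖u‖ + b) ^ 2 *
      (Real.exp (W * ‖u‖) * Real.exp b)) ∂(stdGaussian m) with hC
  have hC0 : 0 ≤ C := integral_nonneg fun u => by positivity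
  have hlin : EB (fun u => ψ u * ⟪u, w⟫) := hψ.mul (EB.inner w)
  set D := ∫ u, ψ (u + w) ∂(stdGaussian m) - ∫ u, ψ u ∂(stdGaussian m) with hD
  set E := ∫ u, ψ u * ⟪u, w⟫ ∂(stdGaussian m) with hE
  have main : ∀ t : ℝ, 0 < t → t ≤ 1 → D ≤ E + t * C := by
    intro t ht ht1
    have s1 : t * D ≤ ∫ u, ψ (u + t • w) ∂(stdGaussian m) - ∫ u, ψ u ∂(stdGaussian m) := by
      rw [hD, ← integral_sub (hsh w).integrable hψ.integrable,
        ← integral_sub (hsh _).integrable hψ.integrable, ← integral_const_mul]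
      refine integral_mono (((hsh w).sub hψ).integrable.const_mul t)
        ((hsh _).sub hψ).integrable fun u => ?_
      have := hc.2 (Set.mem_univ u) (Set.mem_univ (u + w)) (by linarith : 0 ≤ 1 - t) ht.le
        (by ring)
      have e : (1 - t) • u + t • (u + w) = u + t • w := by module
      rw [e] at this
      simp only [smul_eq_mul] at this ⊢
      linarith
    rw [shift_int] at s1
    have hexpc : Continuous (fun u : EE m =>
        Real.exp (⟪u, t • w⟫ - ‖t • w‖ ^ 2 / 2)) := by fun_prop
    have hexp : EB (fun u : EE m => Real.exp (⟪u, t • w⟫ - ‖t • w‖ ^ 2 / 2)) := by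
      refine (EB.expn ‖t • w‖).of_le hexpc fun u => ?_
      rw [abs_of_nonneg (Real.exp_pos _).le]
      apply Real.exp_le_exp.2
      have := real_inner_le_norm u (t • w)
      nlinarith [sq_nonneg ‖t • w‖]
    have s2 : ∫ u, ψ u * Real.exp (⟪u, t • w⟫ - ‖t • w‖ ^ 2 / 2) ∂(stdGaussian m)
        - ∫ u, ψ u ∂(stdGaussian m) ≤ t * E + t ^ 2 * C := by
      rw [hE, hC, ← integral_sub (hψ.mul hexp).integrable hψ.integrable, ← integral_const_mul,
        ← integral_const_mul,
        ← integral_add (hlin.integrable.const_mul _) (hQ.integrable.const_mul _)]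
      refine integral_mono ((hψ.mul hexp).sub hψ).integrable
        ((hlin.integrable.const_mul _).add (hQ.integrable.const_mul _)) fun u => ?_
      simp only
      rw [inner_smul_right, norm_smul, Real.norm_eq_abs, mul_pow, sq_abs, ← hW]
      set a : ℝ := ⟪u, w⟫ with ha
      have hA : |a| ≤ W * ‖u‖ := by
        rw [mul_comm]; exact abs_real_inner_le_norm u w
      have hs : t * a - t ^ 2 * W ^ 2 / 2 = t * (a - t * b) := by rw [hb]; ring
      rw [hs]
      set s := t * (a - t * b) with hs'
      have habs : |a - t * b| ≤ W * ‖u‖ + b := by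
        refine (abs_sub _ _).trans ?_
        rw [abs_of_nonneg (by positivity : 0 ≤ t * b)]
        nlinarith
      have hsa : |s| ≤ W * ‖u‖ + b := by
        rw [hs', abs_mul, abs_of_pos ht]
        nlinarith [abs_nonneg (a - t * b)]
      have hsq : s ^ 2 ≤ t ^ 2 * (W * ‖u‖ + b) ^ 2 := by
        rw [hs', mul_pow]
        have := sq_le_sq' (by linarith [neg_abs_le (a - t * b)]) ((le_abs_self _).trans habs)
        gcongr
      have h2 := exp_second s
      have hee : Real.exp |s| ≤ Real.exp (W * ‖u‖) * Real.exp b := by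
        rw [← Real.exp_add]; exact Real.exp_le_exp.2 hsa
      have h3 : |Real.exp s - 1 - t * a| ≤ t ^ 2 * (b + (W * ‖u‖ + b) ^ 2 *
          (Real.exp (W * ‖u‖) * Real.exp b)) := by
        have e : Real.exp s - 1 - t * a = (Real.exp s - 1 - s) + (- (t ^ 2 * b)) := by
          rw [hs']; ring
        rw [e]
        refine (abs_add_le _ _).trans ?_
        rw [abs_neg, abs_of_nonneg (by positivity : 0 ≤ t ^ 2 * b)]
        have : s ^ 2 * Real.exp |s| ≤ t ^ 2 * (W * ‖u‖ + b) ^ 2 *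
          (Real.exp (W * ‖u‖) * Real.exp b) :=
          mul_le_mul hsq hee (Real.exp_pos _).le (by positivity)
        linarith
      have h4 : ψ u * (Real.exp s - 1 - t * a) ≤ |ψ u| * (t ^ 2 * (b + (W * ‖u‖ + b) ^ 2 *
          (Real.exp (W * ‖u‖) * Real.exp b))) := by
        refine (le_abs_self _).trans ?_
        rw [abs_mul]
        exact mul_le_mul_of_nonneg_left h3 (abs_nonneg _)
      linarith
    have s3 : t * D ≤ t * (E + t * C) := (s1.trans s2).trans_eq (by ring)
    exact le_of_mul_le_mul_left s3 ht
  clear_value C D E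
  clear hQ
  refine le_of_forall_pos_le_add fun ε hε => ?_
  have hpos : 0 < ε / (C + ε) := by positivity
  have h1 : ε / (C + ε) ≤ 1 := by rw [div_le_one (by positivity)]; linarith
  refine (main _ hpos h1).trans ?_
  have : ε / (C + ε) * C ≤ ε := by
    rw [div_mul_eq_mul_div, div_le_iff₀ (by positivity)]
    nlinarith
  linarith

lemma stdG_neg {m : ℕ} (ψ : EE m → ℝ) :
    ∫ u, ψ (-u) ∂(stdGaussian m) = ∫ u, ψ u ∂(stdGaussian m) := by
  rw [stdG_integral, stdG_integral, ← integral_neg_eq_self (fun u => gden m u * ψ u)]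
  simp [gden]

/-- the key inequality about the oracle -/
lemma oracle_ineq {m : ℕ} {φ : EE m → ℝ} {L μ : ℝ} (hL : 0 ≤ L) (hμ : 0 < μ)
    (hl : ∀ u v, |φ u - φ v| ≤ L * ‖u - v‖) (hc : ConcaveOn ℝ Set.univ φ) (p q : EE m) :
    φ q - φ p - μ * L * Real.sqrt m
      ≤ ∫ u, ⟪((φ (p + μ • u) - φ p) / μ) • u, q - p⟫ ∂(stdGaussian m) := by
  set ψ : EE m → ℝ := fun u => φ (p + μ • u) - φ p with hψd
  have hlψ : ∀ u v, |ψ u - ψ v| ≤ (L * μ) * ‖u - v‖ := by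
    intro u v
    have := hl (p + μ • u) (p + μ • v)
    have e : p + μ • u - (p + μ • v) = μ • (u - v) := by module
    rw [e, norm_smul, Real.norm_eq_abs, abs_of_pos hμ] at this
    simp only [hψd, sub_sub_sub_cancel_right]
    linarith
  have hcψ : ConcaveOn ℝ Set.univ ψ := by
    refine ⟨convex_univ, fun u _ v _ a b ha hb hab => ?_⟩
    have := hc.2 (Set.mem_univ (p + μ • u)) (Set.mem_univ (p + μ • v)) ha hb hab
    have e : a • (p + μ • u) + b • (p + μ • v) = p + μ • (a • u + b • v) := by
      have : b = 1 - a := by linarith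
      subst this; module
    rw [e] at this
    simp only [hψd, smul_eq_mul] at this ⊢
    have h2 : a * φ p + b * φ p = φ p := by rw [← add_mul, hab, one_mul]
    linarith
  have key := smooth_ineq hlψ hcψ (μ⁻¹ • (q - p))
  have e1 : ∀ u : EE m, ⟪((φ (p + μ • u) - φ p) / μ) • u, q - p⟫
      = ψ u * ⟪u, μ⁻¹ • (q - p)⟫ := by
    intro u
    rw [inner_smul_left, inner_smul_right]
    simp [hψd]; ring
  simp_rw [e1]
  refine le_trans ?_ key
  have hEB : EB ψ := EB.lip hlψ
  have hEBs : EB (fun u => ψ (u + μ⁻¹ • (q - p))) :=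
    EB.lip (K := L * μ) fun a b => by simpa using hlψ (a + μ⁻¹ • (q - p)) (b + μ⁻¹ • (q - p))
  have hneg : EB (fun u => ψ (-u)) :=
    EB.lip (K := L * μ) fun a b => by
      have := hlψ (-a) (-b)
      rwa [← norm_neg, show -(-a - -b) = a - b by abel] at this
  have k1 : ∫ u, ψ u ∂(stdGaussian m) ≤ 0 := by
    have : ∫ u, (ψ u + ψ (-u)) ∂(stdGaussian m) ≤ 0 := by
      refine integral_nonpos fun u => ?_
      have := hcψ.2 (Set.mem_univ u) (Set.mem_univ (-u)) (by norm_num : (0:ℝ) ≤ 1/2)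
        (by norm_num : (0:ℝ) ≤ 1/2) (by norm_num)
      rw [smul_neg, add_neg_cancel] at this
      simp only [smul_eq_mul, Pi.zero_apply] at this ⊢
      have h0 : ψ 0 = 0 := by simp [hψd]
      linarith
    rw [integral_add hEB.integrable hneg.integrable, stdG_neg] at this
    linarith
  have k2 : φ q - φ p - (μ * L) * ∫ u : EE m, ‖u‖ ∂(stdGaussian m) ≤
      ∫ u, ψ (u + μ⁻¹ • (q - p)) ∂(stdGaussian m) := by
    have e : ∫ u : EE m, ((φ q - φ p) - (μ * L) * ‖u‖) ∂(stdGaussian m)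
        = φ q - φ p - (μ * L) * ∫ u : EE m, ‖u‖ ∂(stdGaussian m) := by
      rw [integral_sub (EB.const _).integrable (EB.nrm.integrable.const_mul _),
        integral_const_mul]
      simp
    rw [← e]
    refine integral_mono ((EB.const _).sub ((EB.const _).mul EB.nrm)).integrable
      hEBs.integrable fun u => ?_
    have e2 : p + μ • (u + μ⁻¹ • (q - p)) = q + μ • u := by
      rw [smul_add, smul_smul, mul_inv_cancel₀ hμ.ne', one_smul]; abel
    simp only [hψd, e2]
    have := hl (q + μ • u) q
    rw [add_sub_cancel_left, norm_smul, Real.norm_eq_abs, abs_of_pos hμ] at this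
    have := (abs_le.1 this).1
    linarith
  have k3 : (μ * L) * ∫ u : EE m, ‖u‖ ∂(stdGaussian m) ≤ (μ * L) * Real.sqrt m :=
    mul_le_mul_of_nonneg_left (stdG_m1 m) (by positivity)
  linarith

lemma proj_le {E : Type*} [NormedAddCommGroup E] [InnerProductSpace ℝ E] {C : Set E}
    (hC : Convex ℝ C) {p q w : E} (h : IsProjOn C p q) (hw : w ∈ C) : ‖q - w‖ ≤ ‖p - w‖ := by
  obtain ⟨hq, hmin⟩ := h
  have hin : ⟪p - q, w - q⟫ ≤ 0 := by
    by_contra hcon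
    push Not at hcon
    set I : ℝ := ⟪p - q, w - q⟫ with hI
    set N := ‖w - q‖ ^ 2 with hN
    have hN0 : 0 ≤ N := by positivity
    set t := I / (N + I) with ht
    have hNI : 0 < N + I := by linarith
    have ht0 : 0 < t := by positivity
    have ht1 : t ≤ 1 := by rw [ht, div_le_one hNI]; linarith
    have hmem : q + t • (w - q) ∈ C := by
      have := hC hq hw (by linarith : 0 ≤ 1 - t) ht0.le (by ring)
      convert this using 1
      module
    have := hmin _ hmem
    have e : p - (q + t • (w - q)) = (p - q) - t • (w - q) := by abel
    have h2 : ‖p - q‖ ^ 2 ≤ ‖p - (q + t • (w - q))‖ ^ 2 := by gcongr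
    rw [e, norm_sub_sq_real (p - q), inner_smul_right, norm_smul, mul_pow, Real.norm_eq_abs, sq_abs,
      ← hI, ← hN] at h2
    have h3 : t * (2 * I) ≤ t * (t * N) := by linarith
    have h4 := le_of_mul_le_mul_left h3 ht0
    have h6 : t * (N + I) = I := div_mul_cancel₀ _ hNI.ne'
    nlinarith [mul_pos ht0 hcon]
  have h5 : ‖p - w‖ ^ 2 = ‖p - q‖ ^ 2 - 2 * ⟪p - q, w - q⟫ + ‖w - q‖ ^ 2 := by
    rw [← norm_sub_sq_real]; congr 2; abel
  rw [norm_sub_rev q w]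
  apply le_of_sq_le_sq _ (norm_nonneg _)
  nlinarith [sq_nonneg ‖p - q‖]

lemma hypercube_convex (n : ℕ) : Convex ℝ (hypercube n) := by
  intro a ha b hb s t hs ht hst i
  have h1 := ha i
  have h2 := hb i
  simp only [Set.mem_Icc, PiLp.add_apply, PiLp.smul_apply, smul_eq_mul] at h1 h2 ⊢
  constructor <;> nlinarith

lemma lovasz_intble {n m : ℕ} (f : Finset (Fin n) → EE m → ℝ) (x : EE n) (y : EE m) :
    IntervalIntegrable (fun τ : ℝ => f (Finset.univ.filter fun i => τ < x i) y) volume 0 1 := by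
  classical
  have hm : Measurable (fun τ : ℝ => f (Finset.univ.filter fun i => τ < x i) y) := by
    let _ : MeasurableSpace (Finset (Fin n)) := ⊤
    have h1 : Measurable (fun τ : ℝ => (Finset.univ.filter fun i => τ < x i)) := by
      refine measurable_to_countable' fun S => ?_
      have : (fun τ : ℝ => (Finset.univ.filter fun i => τ < x i)) ⁻¹' {S}
          = ⋂ i, {τ : ℝ | τ < x i ↔ i ∈ S} := by
        ext τ
        simp [Finset.ext_iff]
      rw [this]
      refine MeasurableSet.iInter fun i => ?_
      by_cases hi : i ∈ S
      · simp only [hi, iff_true]; exact measurableSet_Iio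
      · simp only [hi, iff_false, not_lt]; exact measurableSet_Ici
    exact (measurable_from_top (f := fun S => f S y)).comp h1
  refine (intervalIntegrable_const (c := ∑ S, |f S y|)).mono_fun
    hm.aestronglyMeasurable (Filter.Eventually.of_forall fun τ => ?_)
  simp only [Real.norm_eq_abs]
  refine le_trans ?_ (le_abs_self _)
  exact Finset.single_le_sum (f := fun S => |f S y|) (fun _ _ => abs_nonneg _) (Finset.mem_univ _)

lemma lovasz_lip {n m : ℕ} {f : Finset (Fin n) → EE m → ℝ} {L : ℝ}
    (hlip : ∀ S, ∀ y y' : EE m, |f S y - f S y'| ≤ L * ‖y - y'‖) (x : EE n) (y y' : EE m) :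
    |lovasz f x y - lovasz f x y'| ≤ L * ‖y - y'‖ := by
  unfold lovasz
  rw [← intervalIntegral.integral_sub (lovasz_intble f x y) (lovasz_intble f x y')]
  have := intervalIntegral.norm_integral_le_of_norm_le_const (a := 0) (b := 1)
    (C := L * ‖y - y'‖) (f := fun τ : ℝ => f (Finset.univ.filter fun i => τ < x i) y -
      f (Finset.univ.filter fun i => τ < x i) y') (fun τ _ => hlip _ y y')
  simpa using this

lemma lovasz_conc {n m : ℕ} {f : Finset (Fin n) → EE m → ℝ}
    (hconc : ∀ S, ConcaveOn ℝ Set.univ (f S)) (x : EE n) :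
    ConcaveOn ℝ Set.univ (lovasz f x) := by
  refine ⟨convex_univ, fun y _ y' _ a b ha hb hab => ?_⟩
  unfold lovasz
  simp only [smul_eq_mul]
  rw [← intervalIntegral.integral_const_mul, ← intervalIntegral.integral_const_mul,
    ← intervalIntegral.integral_add ((lovasz_intble f x y).const_mul a)
      ((lovasz_intble f x y').const_mul b)]
  refine intervalIntegral.integral_mono_on (by norm_num)
    (((lovasz_intble f x y).const_mul a).add ((lovasz_intble f x y').const_mul b))
    (lovasz_intble f x _) fun τ _ => ?_
  exact (hconc _).2 (Set.mem_univ y) (Set.mem_univ y') ha hb hab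

end helpers

/-- One step of ZO-EG: for `f` submodular in its first variable and concave and
`L_{0y}`-Lipschitz in its second variable, with Lovász extension `f^L`,
a saddle point `z* = (x*,y*)` of `f^L` on `Z = [0,1]^n × Y`, subgradients
bounded by `L₀`, step sizes `h₁, h₂ > 0` and smoothing parameter `μ > 0`, the
extragradient step from `z = (x,y) ∈ Z` with independent Gaussian samples `u, û`
satisfies `E[f^L(x̂,y*) − f^L(x*,ŷ)] ≤ (‖z−z*‖² − E‖z⁺−z*‖²)/(2h₂)
+ μ L_{0y} √m + (h₂/2 + h₁)(L₀² + L_{0y}²(m+4)²)`. -/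
theorem zoeg_one_step_bound (n m : ℕ)
    (f : Finset (Fin n) → EuclideanSpace ℝ (Fin m) → ℝ)
    (hsub : ∀ y, ∀ S T : Finset (Fin n), f (S ∩ T) y + f (S ∪ T) y ≤ f S y + f T y)
    (hconc : ∀ S : Finset (Fin n), ConcaveOn ℝ Set.univ (f S))
    (L0y : ℝ) (hL0y : 0 < L0y)
    (hlip : ∀ S : Finset (Fin n), ∀ y y' : EuclideanSpace ℝ (Fin m),
      |f S y - f S y'| ≤ L0y * ‖y - y'‖)
    (Y : Set (EuclideanSpace ℝ (Fin m))) (hY : Y.Nonempty)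
    (hYconv : Convex ℝ Y) (hYc : IsCompact Y)
    (xstar : EuclideanSpace ℝ (Fin n)) (ystar : EuclideanSpace ℝ (Fin m))
    (hxs : xstar ∈ hypercube n) (hys : ystar ∈ Y)
    (hsaddle : ∀ x ∈ hypercube n, ∀ y ∈ Y,
      lovasz f xstar y ≤ lovasz f xstar ystar ∧ lovasz f xstar ystar ≤ lovasz f x ystar)
    (g : EuclideanSpace ℝ (Fin n) → EuclideanSpace ℝ (Fin m) → EuclideanSpace ℝ (Fin n))
    (L0 : ℝ)
    (hg_sub : ∀ x ∈ hypercube n, ∀ y ∈ Y, ∀ x' ∈ hypercube n,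
      lovasz f x y + ⟪g x y, x' - x⟫ ≤ lovasz f x' y)
    (hg_bd : ∀ x ∈ hypercube n, ∀ y ∈ Y, ‖g x y‖ ≤ L0)
    (h1 h2 μ : ℝ) (hh1 : 0 < h1) (hh2 : 0 < h2) (hμ : 0 < μ)
    (x : EuclideanSpace ℝ (Fin n)) (y : EuclideanSpace ℝ (Fin m))
    (hx : x ∈ hypercube n) (hy : y ∈ Y)
    (xh : EuclideanSpace ℝ (Fin m) → EuclideanSpace ℝ (Fin n))
    (yh : EuclideanSpace ℝ (Fin m) → EuclideanSpace ℝ (Fin m))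
    (xp : EuclideanSpace ℝ (Fin m) → EuclideanSpace ℝ (Fin m) → EuclideanSpace ℝ (Fin n))
    (yp : EuclideanSpace ℝ (Fin m) → EuclideanSpace ℝ (Fin m) → EuclideanSpace ℝ (Fin m))
    (hstep1 : ∀ u, IsProjOn (hypercube n) (x - h1 • g x y) (xh u)
      ∧ IsProjOn Y (y + h1 • oracle f x y μ u) (yh u))
    (hstep2 : ∀ u uh, IsProjOn (hypercube n) (x - h2 • g (xh u) (yh u)) (xp u uh)
      ∧ IsProjOn Y (y + h2 • oracle f (xh u) (yh u) μ uh) (yp u uh)) :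
    (∫ p : EuclideanSpace ℝ (Fin m) × EuclideanSpace ℝ (Fin m),
        (lovasz f (xh p.1) ystar - lovasz f xstar (yh p.1))
        ∂((stdGaussian m).prod (stdGaussian m)))
      ≤ ((‖x - xstar‖ ^ 2 + ‖y - ystar‖ ^ 2)
          - ∫ p : EuclideanSpace ℝ (Fin m) × EuclideanSpace ℝ (Fin m),
              (‖xp p.1 p.2 - xstar‖ ^ 2 + ‖yp p.1 p.2 - ystar‖ ^ 2)
              ∂((stdGaussian m).prod (stdGaussian m))) / (2 * h2)
        + μ * L0y * Real.sqrt m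
        + (h2 / 2 + h1) * (L0 ^ 2 + L0y ^ 2 * ((m : ℝ) + 4) ^ 2) := by
  classical
  have hL := lovasz_lip hlip
  have hCc := lovasz_conc hconc
  have hhc := hypercube_convex n
  have hL0 : 0 ≤ L0 := (norm_nonneg _).trans (hg_bd x hx y hy)
  -- oracle facts
  have ho_norm : ∀ a b u, ‖oracle f a b μ u‖ ≤ L0y * ‖u‖ ^ 2 := by
    intro a b u
    unfold oracle
    rw [norm_smul, Real.norm_eq_abs, abs_div, abs_of_pos hμ]
    have := hL a (b + μ • u) b
    rw [add_sub_cancel_left, norm_smul, Real.norm_eq_abs, abs_of_pos hμ] at this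
    have h2 : |lovasz f a (b + μ • u) - lovasz f a b| / μ ≤ L0y * ‖u‖ := by
      rw [div_le_iff₀ hμ]; linarith
    calc _ ≤ (L0y * ‖u‖) * ‖u‖ := mul_le_mul_of_nonneg_right h2 (norm_nonneg _)
      _ = _ := by ring
  have ho_sq : ∀ a b u, ‖oracle f a b μ u‖ ^ 2 ≤ L0y ^ 2 * ‖u‖ ^ 4 := by
    intro a b u
    calc _ ≤ (L0y * ‖u‖ ^ 2) ^ 2 := by gcongr; exact ho_norm a b u
      _ = _ := by ring
  have ho_cont : ∀ a b, Continuous (fun u => oracle f a b μ u) := by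
    intro a b
    have hc : Continuous (lovasz f a) := (EB.lip (hL a)).1
    unfold oracle
    fun_prop
  have ho_in : ∀ a b v, EB (fun u => ⟪oracle f a b μ u, v⟫) := by
    intro a b v
    refine (((EB.const L0y).mul (EB.nrm.pow 2)).mul (EB.const ‖v‖)).of_le
      ((ho_cont a b).inner continuous_const) fun u => ?_
    exact (abs_real_inner_le_norm _ _).trans
      (mul_le_mul_of_nonneg_right (ho_norm a b u) (norm_nonneg _))
  set γ := stdGaussian m with hγ
  set K : ℝ := L0y ^ 2 * ((m : ℝ) + 4) ^ 2 with hK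
  have hE4 : EB (fun u : EuclideanSpace ℝ (Fin m) => L0y ^ 2 * ‖u‖ ^ 4) :=
    (EB.const _).mul (EB.nrm.pow 4)
  have hK4 : ∫ u, L0y ^ 2 * ‖u‖ ^ 4 ∂γ ≤ K := by
    rw [integral_const_mul, hγ, stdG_m4, hK]
    have : (0:ℝ) ≤ m := by positivity
    gcongr
    nlinarith
  set D : ℝ := ‖x - xstar‖ ^ 2 + ‖y - ystar‖ ^ 2 with hD
  -- fixed first sample
  have step : ∀ u, lovasz f (xh u) ystar - lovasz f xstar (yh u) ≤
      (D - ∫ v, (‖xp u v - xstar‖ ^ 2 + ‖yp u v - ystar‖ ^ 2) ∂γ) / (2 * h2)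
        + (μ * L0y * Real.sqrt m + (h2 / 2 + h1) * L0 ^ 2 + (h2 / 2 + h1 / 2) * K
        + h1 / 2 * (L0y ^ 2 * ‖u‖ ^ 4)) := by
    intro u
    obtain ⟨p1, p2⟩ := hstep1 u
    have hxh := p1.1
    have hyh := p2.1
    set X := xh u with hX
    set Yh := yh u with hYh
    set G := g X Yh with hG
    set a : EuclideanSpace ℝ (Fin m) → ℝ := fun v => ⟪oracle f X Yh μ v, ystar - Yh⟫ with ha
    have hGn : ‖G‖ ≤ L0 := hg_bd X hxh Yh hyh
    have dx : ‖X - x‖ ≤ h1 * L0 := by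
      refine (proj_le hhc p1 hx).trans ?_
      rw [sub_sub_cancel_left, norm_neg, norm_smul, Real.norm_eq_abs, abs_of_pos hh1]
      exact mul_le_mul_of_nonneg_left (hg_bd x hx y hy) hh1.le
    have dy : ‖Yh - y‖ ≤ h1 * (L0y * ‖u‖ ^ 2) := by
      refine (proj_le hYconv p2 hy).trans ?_
      rw [add_sub_cancel_left, norm_smul, Real.norm_eq_abs, abs_of_pos hh1]
      exact mul_le_mul_of_nonneg_left (ho_norm _ _ _) hh1.le
    have gsub := hg_sub X hxh Yh hyh xstar hxs
    have gx : ⟪G, x - xstar⟫ ≥ lovasz f X Yh - lovasz f xstar Yh - h1 * L0 ^ 2 := by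
      have e : ⟪G, x - xstar⟫ = - ⟪G, xstar - X⟫ - ⟪G, X - x⟫ := by
        rw [← neg_add', ← inner_add_right, ← inner_neg_right]; congr 1; abel
      have := real_inner_le_norm G (X - x)
      have h3 : ‖G‖ * ‖X - x‖ ≤ L0 * (h1 * L0) := mul_le_mul hGn dx (norm_nonneg _) hL0
      rw [e]
      linarith
    have pw : ∀ v, ‖xp u v - xstar‖ ^ 2 + ‖yp u v - ystar‖ ^ 2 ≤
        (D - 2 * h2 * (lovasz f X Yh - lovasz f xstar Yh - h1 * L0 ^ 2) + h2 ^ 2 * L0 ^ 2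
          + h2 * h1 * (L0y ^ 2 * ‖u‖ ^ 4))
        + ((- (2 * h2)) * a v + (h2 ^ 2 + h2 * h1) * (L0y ^ 2 * ‖v‖ ^ 4)) := by
      intro v
      obtain ⟨q1, q2⟩ := hstep2 u v
      set o := oracle f X Yh μ v with ho
      have r1 : ‖xp u v - xstar‖ ^ 2 ≤ ‖x - h2 • G - xstar‖ ^ 2 := by
        gcongr; exact proj_le hhc q1 hxs
      have r2 : ‖yp u v - ystar‖ ^ 2 ≤ ‖y + h2 • o - ystar‖ ^ 2 := by
        gcongr; exact proj_le hYconv q2 hys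
      rw [show x - h2 • G - xstar = (x - xstar) - h2 • G by abel, norm_sub_sq_real (x - xstar),
        inner_smul_right, norm_smul, mul_pow, Real.norm_eq_abs, sq_abs,
        real_inner_comm] at r1
      rw [show y + h2 • o - ystar = (y - ystar) + h2 • o by abel, norm_add_sq_real (y - ystar),
        inner_smul_right, norm_smul, mul_pow, Real.norm_eq_abs, sq_abs,
        real_inner_comm] at r2
      have e : ⟪o, y - ystar⟫ = - a v - ⟪o, Yh - y⟫ := by
        rw [ha]
        simp only
        rw [← neg_add', ← inner_add_right, ← inner_neg_right]; congr 1; abel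
      have c1 : - ⟪o, Yh - y⟫ ≤ h1 / 2 * (L0y ^ 2 * ‖v‖ ^ 4 + L0y ^ 2 * ‖u‖ ^ 4) := by
        have t1 := (abs_le.1 (abs_real_inner_le_norm o (Yh - y))).1
        have t2 : ‖o‖ * ‖Yh - y‖ ≤ (L0y * ‖v‖ ^ 2) * (h1 * (L0y * ‖u‖ ^ 2)) :=
          mul_le_mul (ho_norm _ _ _) dy (norm_nonneg _) (by positivity)
        have t3 : 0 ≤ h1 / 2 * (L0y * ‖v‖ ^ 2 - L0y * ‖u‖ ^ 2) ^ 2 := by positivity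
        linarith
      have c2 : ‖o‖ ^ 2 ≤ L0y ^ 2 * ‖v‖ ^ 4 := ho_sq _ _ _
      have c3 : ‖G‖ ^ 2 ≤ L0 ^ 2 := by gcongr
      have c4 : h2 ^ 2 * ‖o‖ ^ 2 ≤ h2 ^ 2 * (L0y ^ 2 * ‖v‖ ^ 4) := by gcongr
      have c5 : h2 ^ 2 * ‖G‖ ^ 2 ≤ h2 ^ 2 * L0 ^ 2 := by gcongr
      have c6 := mul_le_mul_of_nonneg_left gx (by positivity : 0 ≤ 2 * h2)
      have c7 := mul_le_mul_of_nonneg_left c1 (by positivity : 0 ≤ 2 * h2)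
      rw [e] at r2
      linarith
    have hEa : EB a := ho_in X Yh _
    have hN : ∫ v, (‖xp u v - xstar‖ ^ 2 + ‖yp u v - ystar‖ ^ 2) ∂γ ≤
        (D - 2 * h2 * (lovasz f X Yh - lovasz f xstar Yh - h1 * L0 ^ 2) + h2 ^ 2 * L0 ^ 2
          + h2 * h1 * (L0y ^ 2 * ‖u‖ ^ 4))
        + ((- (2 * h2)) * ∫ v, a v ∂γ + (h2 ^ 2 + h2 * h1) * ∫ v, L0y ^ 2 * ‖v‖ ^ 4 ∂γ) := by
      have i1 := (((EB.const (- (2 * h2))).mul hEa).add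
        ((EB.const (h2 ^ 2 + h2 * h1)).mul hE4))
      have i2 := (EB.const (m := m) (D - 2 * h2 * (lovasz f X Yh - lovasz f xstar Yh
        - h1 * L0 ^ 2) + h2 ^ 2 * L0 ^ 2 + h2 * h1 * (L0y ^ 2 * ‖u‖ ^ 4))).add i1
      refine (integral_mono_of_nonneg (Filter.Eventually.of_forall fun v => ?_) i2.integrable
        (Filter.Eventually.of_forall pw)).trans (le_of_eq ?_)
      · simp only [Pi.zero_apply]; positivity
      · rw [integral_add (EB.const _).integrable i1.integrable,
          integral_add ((EB.const _).mul hEa).integrable ((EB.const _).mul hE4).integrable,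
          integral_const_mul, integral_const_mul]
        simp
        rfl
    have hor : lovasz f X ystar - lovasz f X Yh - μ * L0y * Real.sqrt m ≤ ∫ v, a v ∂γ :=
      oracle_ineq hL0y.le hμ (hL X) (hCc X) Yh ystar
    have hor2 := mul_le_mul_of_nonneg_left hor (by positivity : 0 ≤ 2 * h2)
    have hK5 := mul_le_mul_of_nonneg_left hK4 (by positivity : 0 ≤ h2 ^ 2 + h2 * h1)
    rw [← sub_le_iff_le_add, le_div_iff₀ (by positivity)]
    linarith
  -- averaging
  set Nf : EuclideanSpace ℝ (Fin m) × EuclideanSpace ℝ (Fin m) → ℝ :=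
    fun p => ‖xp p.1 p.2 - xstar‖ ^ 2 + ‖yp p.1 p.2 - ystar‖ ^ 2 with hNf
  have hNf0 : ∀ p, 0 ≤ Nf p := fun p => by simp only [hNf]; positivity
  have havg : ∃ Mf : EuclideanSpace ℝ (Fin m) → ℝ, Integrable Mf γ ∧
      ∫ u, Mf u ∂γ = ∫ p, Nf p ∂(γ.prod γ) ∧ ∀ u, Mf u ≤ ∫ v, Nf (u, v) ∂γ := by
    by_cases hint : Integrable Nf (γ.prod γ)
    · exact ⟨_, hint.integral_prod_left, (integral_prod _ hint).symm, fun u => le_rfl⟩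
    · refine ⟨fun _ => 0, integrable_zero _ _ _, ?_, fun u => integral_nonneg fun v => hNf0 _⟩
      rw [integral_undef hint]; simp
  obtain ⟨Mf, hMi, hMe, hMle⟩ := havg
  set c0 : ℝ := D / (2 * h2) + (μ * L0y * Real.sqrt m + (h2 / 2 + h1) * L0 ^ 2
    + (h2 / 2 + h1 / 2) * K) with hc0
  have hB : Integrable (fun u => (c0 + h1 / 2 * (L0y ^ 2 * ‖u‖ ^ 4)) - (2 * h2)⁻¹ * Mf u) γ :=
    ((EB.const c0).add ((EB.const (h1 / 2)).mul hE4)).integrable.sub (hMi.const_mul _)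
  have hlast : (∫ p : EuclideanSpace ℝ (Fin m) × EuclideanSpace ℝ (Fin m),
        (lovasz f (xh p.1) ystar - lovasz f xstar (yh p.1)) ∂(γ.prod γ))
      ≤ ∫ p : EuclideanSpace ℝ (Fin m) × EuclideanSpace ℝ (Fin m),
        ((c0 + h1 / 2 * (L0y ^ 2 * ‖p.1‖ ^ 4)) - (2 * h2)⁻¹ * Mf p.1) ∂(γ.prod γ) := by
    refine integral_mono_of_nonneg (Filter.Eventually.of_forall fun p => ?_) (hB.comp_fst γ)
      (Filter.Eventually.of_forall fun p => ?_)
    · have := hsaddle (xh p.1) (hstep1 p.1).1.1 (yh p.1) (hstep1 p.1).2.1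
      simp only [Pi.zero_apply]
      linarith
    · simp only
      refine (step p.1).trans ?_
      have h3 := mul_le_mul_of_nonneg_left (hMle p.1) (by positivity : 0 ≤ (2 * h2)⁻¹)
      simp only [hNf] at h3
      rw [hc0, sub_div, div_eq_inv_mul (∫ v, _ ∂γ)]
      linarith
  have j1 : Integrable (fun _ : EuclideanSpace ℝ (Fin m) => c0) γ := (EB.const c0).integrable
  have j2 : Integrable (fun u : EuclideanSpace ℝ (Fin m) => h1 / 2 * (L0y ^ 2 * ‖u‖ ^ 4)) γ :=
    ((EB.const (h1 / 2)).mul hE4).integrable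
  have j3 : Integrable (fun u : EuclideanSpace ℝ (Fin m) =>
      c0 + h1 / 2 * (L0y ^ 2 * ‖u‖ ^ 4)) γ := j1.add j2
  have hpr : IsProbabilityMeasure γ := stdG_prob m
  rw [integral_fun_fst (fun u => (c0 + h1 / 2 * (L0y ^ 2 * ‖u‖ ^ 4)) - (2 * h2)⁻¹ * Mf u),
    integral_sub j3 (hMi.const_mul _), integral_add j1 j2,
    integral_const_mul (h1 / 2), integral_const_mul (2 * h2)⁻¹, hMe] at hlast
  simp only [integral_const, probReal_univ, smul_eq_mul, one_mul] at hlast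
  refine hlast.trans ?_
  have hK6 := mul_le_mul_of_nonneg_left hK4 (by positivity : 0 ≤ h1 / 2)
  rw [hc0, sub_div, div_eq_inv_mul (∫ p, _ ∂(γ.prod γ))]
  linarith
end

section
/- Consider the ZO-EG algorithm: f : 2^{[n]} × ℝ^m → ℝ is submodular in its first variable, concave and L_{0y}-Lipschitz in its second variable, f^L is its Lovász extension in the first variable, Y ⊂ ℝ^m is nonempty convex compact, Z = [0,1]^n × Y, z* = (x*, y*) is a saddle point of f^L on Z, and the subgradients used satisfy ‖g_x(z)‖ ≤ L₀ for all z ∈ Z. With constant step sizes h₁, h₂ > 0, smoothing parameter μ > 0, and initial point z₀ ∈ Z, the iterates for k = 0,…,N are: sample u_k ∼ N(0,I_m), G(z_k) = (g_x(z_k), −((f^L(x_k, y_k+μu_k) − f^L(x_k,y_k))/μ) u_k), ẑ_k = Proj_Z(z_k − h₁ G(z_k)); sample û_k ∼ N(0,I_m) independently, form G(ẑ_k) analogously, z_{k+1} = Proj_Z(z_k − h₂ G(ẑ_k)). Then (1/(N+1)) Σ_{k=0}^N E[R^L(ẑ_k)] ≤ r₀²/(2h₂(N+1)) + (h₂/2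 + h₁)(L₀² + L_{0y}²(m+4)²) + μ L_{0y} m^{1/2}, where r₀ = ‖z₀ − z*‖, R^L(ẑ) = f^L(x̂, y*) − f^L(x*, ŷ) for ẑ = (x̂, ŷ), and the expectation is over all independent Gaussian samples u_0, û_0, …, u_k, û_k. -/
open MeasureTheory Finset RealInnerProductSpace

namespace ZO

local notation "𝔼" m => EuclideanSpace ℝ (Fin m)

noncomputable def dens (m : ℕ) (u : 𝔼 m) : ℝ :=
  (2 * Real.pi) ^ (-(m : ℝ) / 2) * Real.exp (-‖u‖ ^ 2 / 2)

lemma dens_pos (m : ℕ) (u : 𝔼 m) : 0 < dens m u := by unfold dens; positivity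

lemma dens_cont (m : ℕ) : Continuous (dens m) := by unfold dens; fun_prop

lemma dens_meas (m : ℕ) : Measurable fun u : 𝔼 m => ENNReal.ofReal (dens m u) :=
  (dens_cont m).measurable.ennreal_ofReal

lemma gauss_eq (m : ℕ) : stdGaussian m = volume.withDensity fun u => ENNReal.ofReal (dens m u) := rfl

lemma gint_iff {m : ℕ} (g : (𝔼 m) → ℝ) :
    Integrable g (stdGaussian m) ↔ Integrable (fun u => dens m u * g u) volume := by
  rw [gauss_eq, integrable_withDensity_iff_integrable_smul' (dens_meas m)
    (Filter.Eventually.of_forall fun _ => ENNReal.ofReal_lt_top)]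
  simp only [ENNReal.toReal_ofReal (dens_pos m _).le, smul_eq_mul]

lemma gint_eq {m : ℕ} (g : (𝔼 m) → ℝ) :
    ∫ u, g u ∂(stdGaussian m) = ∫ u, dens m u * g u := by
  rw [gauss_eq, integral_withDensity_eq_integral_toReal_smul (dens_meas m)
    (Filter.Eventually.of_forall fun _ => ENNReal.ofReal_lt_top)]
  simp only [ENNReal.toReal_ofReal (dens_pos m _).le, smul_eq_mul]

lemma integrable_gauss0 (m : ℕ) {b : ℝ} (hb : 0 < b) :
    Integrable (fun u : 𝔼 m => Real.exp (-b * ‖u‖ ^ 2)) volume := by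
  have h := (GaussianFourier.integrable_cexp_neg_mul_sq_norm_add (b := (b : ℂ)) (V := 𝔼 m)
    (by simpa using hb) 0 0).norm
  refine h.congr (Filter.Eventually.of_forall fun u => ?_)
  simp only [Complex.norm_exp]
  congr 1
  have : (-(b:ℂ) * (‖u‖:ℂ) ^ 2 + 0 * ((⟪(0: 𝔼 m), u⟫ : ℝ) : ℂ)) = ((-b * ‖u‖^2 : ℝ) : ℂ) := by
    push_cast; ring
  rw [this, Complex.ofReal_re]

lemma dens_integral (m : ℕ) : ∫ u : 𝔼 m, dens m u = 1 := by
  unfold dens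
  rw [integral_const_mul]
  have h := GaussianFourier.integral_rexp_neg_mul_sq_norm (V := 𝔼 m) (b := 1/2) (by norm_num)
  have h2 : ∀ u : 𝔼 m, Real.exp (-‖u‖ ^ 2 / 2) = Real.exp (-(1/2) * ‖u‖ ^ 2) := by
    intro u; congr 1; ring
  simp only [h2]
  rw [h, finrank_euclideanSpace_fin]
  have : Real.pi / (1/2) = 2 * Real.pi := by ring
  rw [this, ← Real.rpow_add (by positivity)]
  have : -(m:ℝ)/2 + m/2 = 0 := by ring
  rw [this, Real.rpow_zero]

lemma dens_integrable (m : ℕ) : Integrable (dens m) volume := by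
  unfold dens
  refine Integrable.const_mul ?_ _
  refine (integrable_gauss0 m (b := 1/2) (by norm_num)).congr (Filter.Eventually.of_forall fun u => ?_)
  simp only; congr 1; ring

instance gauss_prob (m : ℕ) : IsProbabilityMeasure (stdGaussian m) := by
  constructor
  rw [gauss_eq, withDensity_apply _ MeasurableSet.univ, Measure.restrict_univ,
    ← ofReal_integral_eq_lintegral_ofReal (dens_integrable m)
      (Filter.Eventually.of_forall fun u => (dens_pos m u).le), dens_integral]
  simp

lemma gint_exp (m : ℕ) (c : ℝ) : Integrable (fun u : 𝔼 m => Real.exp (c * ‖u‖)) (stdGaussian m) := by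
  rw [gint_iff]
  refine ((integrable_gauss0 m (b := 1/4) (by norm_num)).const_mul
    ((2 * Real.pi) ^ (-(m : ℝ) / 2) * Real.exp (c^2))).mono' ?_ ?_
  · exact ((dens_cont m).mul (by fun_prop)).aestronglyMeasurable
  · refine Filter.Eventually.of_forall fun u => ?_
    rw [Real.norm_of_nonneg (mul_nonneg (dens_pos m u).le (Real.exp_pos _).le)]
    unfold dens
    rw [mul_assoc, mul_assoc, ← Real.exp_add, ← Real.exp_add]
    refine mul_le_mul_of_nonneg_left (Real.exp_le_exp.2 ?_) (by positivity)
    nlinarith [sq_nonneg (‖u‖/2 - c)]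

lemma gint_pow_exp (m i : ℕ) (c : ℝ) :
    Integrable (fun u : 𝔼 m => ‖u‖ ^ i * Real.exp (c * ‖u‖)) (stdGaussian m) := by
  refine (gint_exp m (i + c)).mono' ?_ ?_
  · exact (by fun_prop : Continuous fun u : 𝔼 m => ‖u‖ ^ i * Real.exp (c * ‖u‖)).aestronglyMeasurable
  · refine Filter.Eventually.of_forall fun u => ?_
    rw [Real.norm_of_nonneg (by positivity), add_mul, Real.exp_add]
    refine mul_le_mul_of_nonneg_right ?_ (Real.exp_pos _).le
    rw [Real.exp_nat_mul]
    exact pow_le_pow_left₀ (norm_nonneg _) (by linarith [Real.add_one_le_exp ‖u‖]) _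

lemma gint_pow (m i : ℕ) : Integrable (fun u : 𝔼 m => ‖u‖ ^ i) (stdGaussian m) := by
  simpa using gint_pow_exp m i 0

lemma moment_rec (m p : ℕ) (hm : 0 < m) :
    ∫ u : 𝔼 m, ‖u‖ ^ (p + 2) ∂(stdGaussian m) = (m + p) * ∫ u : 𝔼 m, ‖u‖ ^ p ∂(stdGaussian m) := by
  have : Nontrivial (𝔼 m) := by
    apply Module.nontrivial_of_finrank_pos (R := ℝ)
    rw [finrank_euclideanSpace_fin]; exact hm
  have key : ∀ q : ℕ, ∫ u : 𝔼 m, ‖u‖ ^ q ∂(stdGaussian m) =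
      ((2 * Real.pi) ^ (-(m : ℝ) / 2) * m * (volume.real (Metric.ball (0 : 𝔼 m) 1))) *
        ((1/2:ℝ) ^ (-((m + q : ℕ) : ℝ) / 2) * (1 / 2) * Real.Gamma (((m + q : ℕ) : ℝ) / 2)) := by
    intro q
    rw [gint_eq]
    unfold dens
    rw [integral_fun_norm_addHaar volume
      (fun r => (2 * Real.pi) ^ (-(m : ℝ) / 2) * Real.exp (-r ^ 2 / 2) * r ^ q)]
    have h := integral_rpow_mul_exp_neg_mul_rpow (p := 2) (q := (m + q : ℕ) - 1) (b := 1/2) (by norm_num)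
      (by push_cast; have : (0:ℝ) < m := by exact_mod_cast hm
          have : (0:ℝ) ≤ q := by positivity
          linarith) (by norm_num)
    rw [sub_add_cancel] at h
    rw [← h, finrank_euclideanSpace_fin, nsmul_eq_mul, smul_eq_mul]
    have : ∫ y in Set.Ioi (0:ℝ), y ^ (m - 1) • ((2 * Real.pi) ^ (-(m : ℝ) / 2) * Real.exp (-y ^ 2 / 2) * y ^ q)
      = (2 * Real.pi) ^ (-(m : ℝ) / 2) * ∫ x in Set.Ioi (0:ℝ), x ^ (((m + q : ℕ):ℝ) - 1) * Real.exp (-(1/2) * x ^ (2:ℝ)) := by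
      rw [← integral_const_mul]
      refine setIntegral_congr_fun measurableSet_Ioi fun x hx => ?_
      have hx : 0 < x := hx
      have e1 : x ^ (((m + q : ℕ):ℝ) - 1) = x ^ (m - 1) * x ^ q := by
        rw [← pow_add, ← Real.rpow_natCast]
        congr 1
        have : m - 1 + q = m + q - 1 := by omega
        rw [this, Nat.cast_sub (by omega)]; simp
      have e2 : x ^ (2:ℝ) = x ^ 2 := by exact_mod_cast Real.rpow_natCast x 2
      simp only [e1, e2, smul_eq_mul]
      have e3 : -x^2/2 = -(1/2) * x^2 := by ring
      rw [e3]; ring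
    rw [this]; ring
  rw [key, key]
  have hpos : (0:ℝ) < ((m + p : ℕ) : ℝ) := by exact_mod_cast (by omega : 0 < m + p)
  have e1 : ((m + (p + 2) : ℕ) : ℝ) / 2 = ((m + p : ℕ) : ℝ) / 2 + 1 := by push_cast; ring
  have e2 : -((m + (p + 2) : ℕ) : ℝ) / 2 = -((m + p : ℕ) : ℝ) / 2 + (-1) := by push_cast; ring
  rw [e1, e2, Real.Gamma_add_one (by positivity), Real.rpow_add (by norm_num), Real.rpow_neg_one]
  push_cast; ring

lemma moment2 (m : ℕ) : ∫ u : 𝔼 m, ‖u‖ ^ 2 ∂(stdGaussian m) = m := by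
  rcases Nat.eq_zero_or_pos m with rfl | hm
  · have : ∀ u : 𝔼 0, ‖u‖ = 0 := fun u => by rw [Subsingleton.elim u 0, norm_zero]
    simp [this]
  · have := moment_rec m 0 hm
    simpa using this

lemma moment4 (m : ℕ) : ∫ u : 𝔼 m, ‖u‖ ^ 4 ∂(stdGaussian m) ≤ ((m:ℝ) + 4) ^ 2 := by
  have hm0 : (0:ℝ) ≤ m := by positivity
  rcases Nat.eq_zero_or_pos m with rfl | hm
  · have : ∀ u : 𝔼 0, ‖u‖ = 0 := fun u => by rw [Subsingleton.elim u 0, norm_zero]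
    simp [this]
  · have := moment_rec m 2 hm
    rw [moment2] at this
    norm_num at this
    rw [this]; nlinarith

lemma moment1 (m : ℕ) : ∫ u : 𝔼 m, ‖u‖ ∂(stdGaussian m) ≤ Real.sqrt m := by
  rcases Nat.eq_zero_or_pos m with rfl | hm
  · have : ∀ u : 𝔼 0, ‖u‖ = 0 := fun u => by rw [Subsingleton.elim u 0, norm_zero]
    simp [this]
  have hs : 0 < Real.sqrt m := Real.sqrt_pos.2 (by exact_mod_cast hm)
  have hss : Real.sqrt m * Real.sqrt m = m := Real.mul_self_sqrt (by positivity)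
  have h1 : Integrable (fun u : 𝔼 m => ‖u‖) (stdGaussian m) := by simpa using gint_pow m 1
  have h : ∫ u : 𝔼 m, 2 * Real.sqrt m * ‖u‖ ∂(stdGaussian m) ≤
      ∫ u : 𝔼 m, (‖u‖ ^ 2 + m) ∂(stdGaussian m) := by
    refine integral_mono (h1.const_mul _) ((gint_pow m 2).add (integrable_const _)) fun u => ?_
    simp only
    nlinarith [sq_nonneg (‖u‖ - Real.sqrt m)]
  rw [integral_const_mul, integral_add (gint_pow m 2) (integrable_const _), moment2] at h
  simp at h
  nlinarith

lemma gauss_shift {m : ℕ} (F : (𝔼 m) → ℝ) (s : 𝔼 m) :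
    ∫ u, F (u + s) ∂(stdGaussian m) =
      ∫ u, F u * Real.exp (⟪s, u⟫ - ‖s‖ ^ 2 / 2) ∂(stdGaussian m) := by
  rw [gint_eq, gint_eq, ← integral_add_right_eq_self (μ := volume)
    (fun u => dens m u * (F u * Real.exp (⟪s, u⟫ - ‖s‖ ^ 2 / 2))) s]
  congr 1; ext u
  unfold dens
  have : Real.exp (-‖u‖ ^ 2 / 2) = Real.exp (-‖u + s‖ ^ 2 / 2) * Real.exp (⟪s, u + s⟫ - ‖s‖ ^ 2 / 2) := by
    rw [← Real.exp_add, norm_add_sq_real, inner_add_right, real_inner_self_eq_norm_sq, real_inner_comm]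
    congr 1; ring
  rw [this]; ring

lemma gauss_neg {m : ℕ} (F : (𝔼 m) → ℝ) :
    ∫ u, F (-u) ∂(stdGaussian m) = ∫ u, F u ∂(stdGaussian m) := by
  rw [gint_eq, gint_eq, ← integral_neg_eq_self (fun u => dens m u * F u)]
  congr 1; ext u; unfold dens; rw [norm_neg]

lemma exp_bound (a b B t : ℝ) (hb : 0 ≤ b) (ha : |a| ≤ B) (ht : 0 < t) (ht1 : t ≤ 1) :
    |Real.exp (t * a - t ^ 2 * b) - 1 - t * a| ≤ t ^ 2 * ((B + b) ^ 2 * Real.exp (B + b) + b) := by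
  set x := t * a - t ^ 2 * b with hx
  have hB : 0 ≤ B := (abs_nonneg a).trans ha
  have h := Complex.norm_exp_sub_sum_le_norm_mul_exp (x : ℂ) 2
  simp [Finset.sum_range_succ] at h
  have h' : |Real.exp x - (1 + x)| ≤ |x| ^ 2 * Real.exp |x| := by
    have e : Complex.exp (x:ℂ) - (1 + (x:ℂ)) = ((Real.exp x - (1 + x) : ℝ) : ℂ) := by push_cast; rfl
    rw [e, Complex.norm_real] at h
    simpa using h
  have hxb : |x| ≤ t * (B + b) := by
    have := abs_le.1 ha
    rw [abs_le]
    constructor <;> nlinarith [mul_nonneg ht.le hb, mul_nonneg (mul_nonneg ht.le hb) (sub_nonneg.2 ht1)]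
  have hxb' : |x| ≤ B + b := hxb.trans (by nlinarith)
  have h2 : |x| ^ 2 * Real.exp |x| ≤ (t * (B + b)) ^ 2 * Real.exp (B + b) := by gcongr
  have e : Real.exp x - 1 - t * a = (Real.exp x - (1 + x)) + (- (t ^ 2 * b)) := by rw [hx]; ring
  rw [e]
  refine (abs_add_le _ _).trans ?_
  rw [abs_neg, abs_of_nonneg (by positivity : 0 ≤ t ^ 2 * b)]
  nlinarith

lemma stein {m : ℕ} (φ : (𝔼 m) → ℝ) (hc : ConcaveOn ℝ Set.univ φ) (L : ℝ) (hL : 0 < L)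
    (hl : ∀ y y', |φ y - φ y'| ≤ L * ‖y - y'‖) (μ : ℝ) (hμ : 0 < μ) (y v : 𝔼 m) :
    φ (y + v) - φ y - μ * L * Real.sqrt m ≤
      ∫ u, (φ (y + μ • u) - φ y) / μ * ⟪u, v⟫ ∂(stdGaussian m) := by
  have hφc : Continuous φ := by
    have : LipschitzWith (Real.toNNReal L) φ := by
      refine LipschitzWith.of_dist_le_mul fun a b => ?_
      rw [Real.dist_eq, dist_eq_norm, Real.coe_toNNReal L hL.le]; exact hl a b
    exact this.continuous
  set F : (𝔼 m) → ℝ := fun u => φ (y + μ • u) - φ y with hF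
  set s : 𝔼 m := μ⁻¹ • v with hs
  have hFc : Continuous F := by rw [hF]; fun_prop
  have hFb : ∀ u, |F u| ≤ L * μ * ‖u‖ := fun u => by
    have := hl (y + μ • u) y
    rw [add_sub_cancel_left, norm_smul, Real.norm_of_nonneg hμ.le] at this
    simpa [hF, mul_assoc] using this
  have hnorm : Integrable (fun u : 𝔼 m => ‖u‖) (stdGaussian m) := by simpa using gint_pow m 1
  have hFi : ∀ r : 𝔼 m, Integrable (fun u => F (u + r)) (stdGaussian m) := fun r => by
    refine ((hnorm.add (integrable_const ‖r‖)).const_mul (L * μ)).mono' ?_ ?_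
    · exact (by fun_prop : Continuous fun u => F (u + r)).aestronglyMeasurable
    · refine Filter.Eventually.of_forall fun u => ?_
      exact (hFb _).trans (mul_le_mul_of_nonneg_left (norm_add_le _ _) (by positivity))
  have hFi0 : Integrable F (stdGaussian m) := by simpa using hFi 0
  have hFs : ∀ (u : 𝔼 m), F (u + s) = φ (y + v + μ • u) - φ y := fun u => by
    simp only [hF, hs]; congr 2
    rw [smul_add, smul_smul, mul_inv_cancel₀ hμ.ne', one_smul]; abel
  set D := φ (y + v) - φ y - μ * L * Real.sqrt m with hD
  -- A 0 ≤ 0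
  have hA0 : ∫ u, F u ∂(stdGaussian m) ≤ 0 := by
    have hn : Integrable (fun u => F (-u)) (stdGaussian m) := by
      refine (hnorm.const_mul (L * μ)).mono' ?_ ?_
      · exact (by fun_prop : Continuous fun u => F (-u)).aestronglyMeasurable
      · refine Filter.Eventually.of_forall fun u => ?_
        simpa using hFb (-u)
    have h : ∫ u, (F u + F (-u)) ∂(stdGaussian m) ≤ 0 := by
      refine integral_nonpos fun u => ?_
      have := hc.2 (Set.mem_univ (y + μ • u)) (Set.mem_univ (y + μ • (-u)))
        (by norm_num : (0:ℝ) ≤ 1/2) (by norm_num : (0:ℝ) ≤ 1/2) (by norm_num)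
      have e : (1/2:ℝ) • (y + μ • u) + (1/2:ℝ) • (y + μ • (-u)) = y := by
        module
      rw [e] at this
      simp only [smul_eq_mul] at this
      simp only [hF, Pi.zero_apply]; linarith
    rw [integral_add hFi0 hn, gauss_neg] at h
    linarith
  have hA1 : D ≤ ∫ u, F (u + s) ∂(stdGaussian m) := by
    have h : ∫ u, (φ (y + v) - φ y - μ * L * ‖u‖) ∂(stdGaussian m) ≤ ∫ u, F (u + s) ∂(stdGaussian m) := by
      refine integral_mono ((integrable_const _).sub (hnorm.const_mul _)) (hFi s) fun u => ?_
      simp only [hFs]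
      have := hl (y + v) (y + v + μ • u)
      rw [sub_add_cancel_left, norm_neg, norm_smul, Real.norm_of_nonneg hμ.le] at this
      have := (abs_le.1 this).2
      nlinarith
    rw [integral_sub (integrable_const _) (hnorm.const_mul _), integral_const_mul] at h
    simp at h
    have := mul_le_mul_of_nonneg_left (moment1 m) (mul_pos hμ hL).le
    rw [hD]; linarith
  have hlow : ∀ t : ℝ, 0 < t → t ≤ 1 → t * D ≤ ∫ u, F (u + t • s) ∂(stdGaussian m) - ∫ u, F u ∂(stdGaussian m) := by
    intro t ht ht1
    have h : ∫ u, ((1 - t) * F u + t * F (u + s)) ∂(stdGaussian m) ≤ ∫ u, F (u + t • s) ∂(stdGaussian m) := by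
      refine integral_mono ((hFi0.const_mul _).add ((hFi s).const_mul _)) (hFi _) fun u => ?_
      have := hc.2 (Set.mem_univ (y + μ • u)) (Set.mem_univ (y + μ • (u + s)))
        (by linarith : (0:ℝ) ≤ 1 - t) ht.le (by ring)
      have e : (1 - t) • (y + μ • u) + t • (y + μ • (u + s)) = y + μ • (u + t • s) := by
        module
      rw [e] at this
      simp only [smul_eq_mul] at this
      simp only [hF]; linarith
    rw [integral_add (hFi0.const_mul _) ((hFi s).const_mul _), integral_const_mul, integral_const_mul] at h
    nlinarith
  set b : ℝ := ‖s‖ ^ 2 / 2 with hb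
  have hb0 : 0 ≤ b := by positivity
  set Dom : (𝔼 m) → ℝ := fun u => L * μ * ‖u‖ * ((‖s‖ * ‖u‖ + b) ^ 2 * Real.exp (‖s‖ * ‖u‖ + b) + b) with hDom
  have hDomi : Integrable Dom (stdGaussian m) := by
    have i1 := (gint_pow_exp m 3 ‖s‖).const_mul (L * μ * ‖s‖ ^ 2 * Real.exp b)
    have i2 := (gint_pow_exp m 2 ‖s‖).const_mul (L * μ * (2 * ‖s‖ * b) * Real.exp b)
    have i3 := (gint_pow_exp m 1 ‖s‖).const_mul (L * μ * b ^ 2 * Real.exp b)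
    have i4 := (gint_pow m 1).const_mul (L * μ * b)
    refine (((i1.add i2).add i3).add i4).congr (Filter.Eventually.of_forall fun u => ?_)
    simp only [hDom, Pi.add_apply, Real.exp_add]
    ring
  have hsu : Integrable (fun u => F u * ⟪s, u⟫) (stdGaussian m) := by
    refine ((gint_pow m 2).const_mul (L * μ * ‖s‖)).mono' ?_ ?_
    · exact (by fun_prop : Continuous fun u => F u * ⟪s, u⟫).aestronglyMeasurable
    · refine Filter.Eventually.of_forall fun u => ?_
      rw [norm_mul]
      calc ‖F u‖ * ‖⟪s, u⟫‖ ≤ (L * μ * ‖u‖) * (‖s‖ * ‖u‖) :=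
            mul_le_mul (hFb u) (norm_inner_le_norm s u) (norm_nonneg _) (by positivity)
        _ = _ := by ring
  set K := ∫ u, Dom u ∂(stdGaussian m) with hK
  have hmain : ∀ t : ℝ, 0 < t → t ≤ 1 → D - ∫ u, F u * ⟪s, u⟫ ∂(stdGaussian m) ≤ t * K := by
    intro t ht ht1
    have h := hlow t ht ht1
    have hsh := gauss_shift F (t • s)
    have hpt : ∀ u : 𝔼 m, ‖F u * Real.exp (⟪t • s, u⟫ - ‖t • s‖ ^ 2 / 2) - F u - t * (F u * ⟪s, u⟫)‖ ≤ t ^ 2 * Dom u := by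
      intro u
      have e : ⟪t • s, u⟫ - ‖t • s‖ ^ 2 / 2 = t * ⟪s, u⟫ - t ^ 2 * b := by
        rw [real_inner_smul_left, norm_smul, Real.norm_of_nonneg ht.le, hb]; ring
      rw [e]
      have e2 : F u * Real.exp (t * ⟪s, u⟫ - t ^ 2 * b) - F u - t * (F u * ⟪s, u⟫) =
        F u * (Real.exp (t * ⟪s, u⟫ - t ^ 2 * b) - 1 - t * ⟪s, u⟫) := by ring
      rw [e2, norm_mul]
      calc _ ≤ (L * μ * ‖u‖) * (t ^ 2 * ((‖s‖ * ‖u‖ + b) ^ 2 * Real.exp (‖s‖ * ‖u‖ + b) + b)) :=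
            mul_le_mul (hFb u) (exp_bound _ b (‖s‖ * ‖u‖) t hb0 (abs_real_inner_le_norm s u) ht ht1)
              (abs_nonneg _) (by positivity)
        _ = _ := by rw [hDom]; ring
    have hci : Integrable (fun u => F u * Real.exp (⟪t • s, u⟫ - ‖t • s‖ ^ 2 / 2) - F u - t * (F u * ⟪s, u⟫)) (stdGaussian m) := by
      refine (hDomi.const_mul (t^2)).mono' ?_ (Filter.Eventually.of_forall hpt)
      exact (by fun_prop : Continuous fun u => F u * Real.exp (⟪t • s, u⟫ - ‖t • s‖ ^ 2 / 2) - F u - t * (F u * ⟪s, u⟫)).aestronglyMeasurable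
    have hei : Integrable (fun u => F u * Real.exp (⟪t • s, u⟫ - ‖t • s‖ ^ 2 / 2)) (stdGaussian m) := by
      refine ((hci.add hFi0).add (hsu.const_mul t)).congr (Filter.Eventually.of_forall fun u => ?_)
      simp only [Pi.add_apply]; ring
    have hle := integral_mono hci (hDomi.const_mul (t^2)) fun u => (le_abs_self _).trans (hpt u)
    have hef : Integrable (fun u => F u * Real.exp (⟪t • s, u⟫ - ‖t • s‖ ^ 2 / 2) - F u) (stdGaussian m) :=
      hei.sub hFi0
    rw [integral_sub hef (hsu.const_mul t), integral_sub hei hFi0, integral_const_mul,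
      integral_const_mul, ← hsh] at hle
    have : t * (D - ∫ u, F u * ⟪s, u⟫ ∂(stdGaussian m)) ≤ t * (t * K) := by
      rw [← hK] at hle
      nlinarith
    exact le_of_mul_le_mul_left this ht
  have hfin : D - ∫ u, F u * ⟪s, u⟫ ∂(stdGaussian m) ≤ 0 := by
    by_contra hcon
    push Not at hcon
    set d := D - ∫ u, F u * ⟪s, u⟫ ∂(stdGaussian m) with hd
    have hK0 : 0 < K := by
      have := hmain 1 one_pos le_rfl
      linarith
    have := hmain (min 1 (d / (2 * K))) (lt_min one_pos (by positivity)) (min_le_left _ _)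
    have h3 : min 1 (d / (2 * K)) * K ≤ d / (2 * K) * K := mul_le_mul_of_nonneg_right (min_le_right _ _) hK0.le
    have h4 : d / (2 * K) * K = d / 2 := by field_simp
    linarith
  have e : ∀ u, (φ (y + μ • u) - φ y) / μ * ⟪u, v⟫ = F u * ⟪s, u⟫ := fun u => by
    simp only [hF, hs]
    rw [real_inner_smul_left, real_inner_comm]
    field_simp
  simp only [e]
  linarith

/-! Projections -/

lemma proj_inner {E : Type*} [NormedAddCommGroup E] [InnerProductSpace ℝ E] {C : Set E}
    (hC : Convex ℝ C) {p q : E} (h : IsProjOn C p q) : ∀ w ∈ C, ⟪p - q, w - q⟫ ≤ 0 := by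
  refine (norm_eq_iInf_iff_real_inner_le_zero hC h.1).1 ?_
  have : Nonempty C := ⟨⟨q, h.1⟩⟩
  refine le_antisymm (le_ciInf fun w => h.2 w w.2) ?_
  exact ciInf_le (f := fun w : C => ‖p - w‖) ⟨0, by rintro _ ⟨w, rfl⟩; exact norm_nonneg _⟩ ⟨q, h.1⟩

lemma proj_unique {E : Type*} [NormedAddCommGroup E] [InnerProductSpace ℝ E] {C : Set E}
    (hC : Convex ℝ C) {p q q' : E} (h : IsProjOn C p q) (h' : IsProjOn C p q') : q = q' := by
  have h1 := proj_inner hC h q' h'.1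
  have h2 := proj_inner hC h' q h.1
  have e : ⟪p - q, q' - q⟫ + ⟪p - q', q - q'⟫ = ‖q - q'‖ ^ 2 := by
    rw [← real_inner_self_eq_norm_sq]
    simp only [inner_sub_left, inner_sub_right]
    ring
  have : ‖q - q'‖ ^ 2 ≤ 0 := by linarith
  have : ‖q - q'‖ = 0 := by nlinarith [norm_nonneg (q - q')]
  exact sub_eq_zero.1 (norm_eq_zero.1 this)

lemma proj_dist {E : Type*} [NormedAddCommGroup E] [InnerProductSpace ℝ E] {C : Set E}
    (hC : Convex ℝ C) {p q w : E} (h : IsProjOn C p q) (hw : w ∈ C) :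
    ‖q - w‖ ^ 2 ≤ ‖p - w‖ ^ 2 := by
  have h1 := proj_inner hC h w hw
  have e : p - w = (p - q) - (w - q) := by abel
  have e2 : ‖q - w‖ = ‖w - q‖ := norm_sub_rev _ _
  rw [e, e2, norm_sub_sq_real (p - q) (w - q)]
  nlinarith [sq_nonneg ‖p - q‖]

lemma eg_step {E : Type*} [NormedAddCommGroup E] [InnerProductSpace ℝ E] {C : Set E}
    (hC : Convex ℝ C) {p w q r a b : E} {h1 h2 : ℝ} (hh1 : 0 < h1) (hh2 : 0 < h2)
    (hp : p ∈ C) (hw : w ∈ C) (hq : IsProjOn C (p + h1 • a) q) (hr : IsProjOn C (p + h2 • b) r) :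
    ‖r - w‖ ^ 2 ≤ ‖p - w‖ ^ 2 + 2 * h2 * ⟪b, q - w⟫ + (h2 ^ 2 + h1 * h2) * ‖b‖ ^ 2
      + h1 * h2 * ‖a‖ ^ 2 := by
  have A := proj_dist hC hr hw
  have e : p + h2 • b - w = (p - w) + h2 • b := by abel
  rw [e, norm_add_sq_real, norm_smul, real_inner_smul_right, Real.norm_of_nonneg hh2.le] at A
  have B : ‖q - p‖ ≤ h1 * ‖a‖ := by
    have := proj_dist hC hq hp
    rw [add_sub_cancel_left, norm_smul, Real.norm_of_nonneg hh1.le] at this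
    exact (pow_le_pow_iff_left₀ (norm_nonneg _) (by positivity) two_ne_zero).1 this
  have e3 : ⟪p - w, b⟫ = ⟪b, q - w⟫ + ⟪b, p - q⟫ := by
    rw [real_inner_comm, ← inner_add_right]; congr 1; abel
  have D : ⟪b, p - q⟫ ≤ ‖b‖ * (h1 * ‖a‖) := by
    refine (real_inner_le_norm _ _).trans ?_
    rw [norm_sub_rev]
    exact mul_le_mul_of_nonneg_left B (norm_nonneg _)
  rw [e3] at A
  have F : 2 * h2 * ⟪b, p - q⟫ ≤ 2 * h2 * (‖b‖ * (h1 * ‖a‖)) :=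
    mul_le_mul_of_nonneg_left D (by positivity)
  have G : 0 ≤ h1 * h2 * (‖a‖ - ‖b‖) ^ 2 := by positivity
  nlinarith

lemma cube_convex (n : ℕ) : Convex ℝ (hypercube n) := by
  intro x hx y hy a b ha hb hab i
  have := convex_Icc (0:ℝ) 1 (hx i) (hy i) ha hb hab
  simpa using this

/-! Lovász -/

lemma lov_meas {n : ℕ} {α : Type*} (f : Finset (Fin n) → α → ℝ) (x : 𝔼 n) (y : α) :
    Measurable fun τ : ℝ => f (Finset.univ.filter fun i => τ < x i) y := by
  have h : ∀ s : Finset (Fin n), MeasurableSet {τ : ℝ | (Finset.univ.filter fun i => τ < x i) = s} := by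
    intro s
    have : {τ : ℝ | (Finset.univ.filter fun i => τ < x i) = s} = ⋂ i, {τ : ℝ | τ < x i ↔ i ∈ s} := by
      ext τ; simp [Finset.ext_iff]
    rw [this]
    refine MeasurableSet.iInter fun i => ?_
    by_cases hi : i ∈ s
    · simp only [hi, iff_true]; exact measurableSet_Iio
    · simp only [hi, iff_false, not_lt]; exact measurableSet_Ici
  let _ : MeasurableSpace (Finset (Fin n)) := ⊤
  have h1 : Measurable fun τ : ℝ => (Finset.univ.filter fun i => τ < x i) :=
    measurable_to_countable' h
  exact (measurable_from_top (f := fun s => f s y)).comp h1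

lemma lov_int {n : ℕ} {α : Type*} (f : Finset (Fin n) → α → ℝ) (x : 𝔼 n) (y : α) :
    IntervalIntegrable (fun τ : ℝ => f (Finset.univ.filter fun i => τ < x i) y) volume 0 1 := by
  refine (intervalIntegrable_const (c := ∑ s, |f s y|)).mono_fun (lov_meas f x y).aestronglyMeasurable ?_
  refine Filter.Eventually.of_forall fun τ => ?_
  rw [Real.norm_of_nonneg (Finset.sum_nonneg fun _ _ => abs_nonneg _)]
  exact Finset.single_le_sum (f := fun s => |f s y|) (fun _ _ => abs_nonneg _) (Finset.mem_univ _)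

lemma lov_lip {n m : ℕ} (f : Finset (Fin n) → (𝔼 m) → ℝ) (L : ℝ)
    (hlip : ∀ S : Finset (Fin n), ∀ y y' : 𝔼 m, |f S y - f S y'| ≤ L * ‖y - y'‖) (x : 𝔼 n) (y y' : 𝔼 m) :
    |lovasz f x y - lovasz f x y'| ≤ L * ‖y - y'‖ := by
  unfold lovasz
  rw [← intervalIntegral.integral_sub (lov_int f x y) (lov_int f x y')]
  have := intervalIntegral.norm_integral_le_of_norm_le_const (a := 0) (b := 1) (C := L * ‖y - y'‖)
    (f := fun τ : ℝ => f (Finset.univ.filter fun i => τ < x i) y - f (Finset.univ.filter fun i => τ < x i) y')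
    (fun τ _ => hlip _ _ _)
  simpa using this

lemma lov_conc {n m : ℕ} (f : Finset (Fin n) → (𝔼 m) → ℝ)
    (hconc : ∀ S : Finset (Fin n), ConcaveOn ℝ Set.univ (f S)) (x : 𝔼 n) :
    ConcaveOn ℝ Set.univ (lovasz f x) := by
  refine ⟨convex_univ, fun y _ y' _ a b ha hb hab => ?_⟩
  unfold lovasz
  simp only [smul_eq_mul]
  rw [← intervalIntegral.integral_const_mul, ← intervalIntegral.integral_const_mul,
    ← intervalIntegral.integral_add ((lov_int f x y).const_mul a) ((lov_int f x y').const_mul b)]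
  refine intervalIntegral.integral_mono_on zero_le_one
    (((lov_int f x y).const_mul a).add ((lov_int f x y').const_mul b)) (lov_int f x _) fun τ _ => ?_
  exact (hconc _).2 (Set.mem_univ y) (Set.mem_univ y') ha hb hab

lemma oracle_norm {n m : ℕ} (f : Finset (Fin n) → (𝔼 m) → ℝ) (L : ℝ)
    (hlip : ∀ S : Finset (Fin n), ∀ y y' : 𝔼 m, |f S y - f S y'| ≤ L * ‖y - y'‖) (x : 𝔼 n) (y : 𝔼 m)
    (μ : ℝ) (hμ : 0 < μ) (u : 𝔼 m) : ‖oracle f x y μ u‖ ≤ L * ‖u‖ ^ 2 := by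
  unfold oracle
  have := lov_lip f L hlip x (y + μ • u) y
  rw [add_sub_cancel_left, norm_smul, Real.norm_of_nonneg hμ.le] at this
  rw [norm_smul, norm_div, Real.norm_of_nonneg hμ.le, Real.norm_eq_abs]
  have h2 : |lovasz f x (y + μ • u) - lovasz f x y| / μ ≤ L * ‖u‖ := by
    rw [div_le_iff₀ hμ]; linarith
  calc _ ≤ L * ‖u‖ * ‖u‖ := mul_le_mul_of_nonneg_right h2 (norm_nonneg _)
    _ = _ := by ring

lemma oracle_cont {n m : ℕ} (f : Finset (Fin n) → (𝔼 m) → ℝ) (L : ℝ) (hL : 0 < L)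
    (hlip : ∀ S : Finset (Fin n), ∀ y y' : 𝔼 m, |f S y - f S y'| ≤ L * ‖y - y'‖) (x : 𝔼 n) (y : 𝔼 m)
    (μ : ℝ) : Continuous (oracle f x y μ) := by
  have : LipschitzWith (Real.toNNReal L) (lovasz f x) := by
    refine LipschitzWith.of_dist_le_mul fun a b => ?_
    rw [Real.dist_eq, dist_eq_norm, Real.coe_toNNReal L hL.le]; exact lov_lip f L hlip x a b
  have := this.continuous
  unfold oracle
  fun_prop

lemma ofReal_integral_le {α : Type*} [MeasurableSpace α] (ν : Measure α) (F : α → ℝ) (hF : ∀ a, 0 ≤ F a) :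
    ENNReal.ofReal (∫ a, F a ∂ν) ≤ ∫⁻ a, ENNReal.ofReal (F a) ∂ν := by
  by_cases h : Integrable F ν
  · exact (ofReal_integral_eq_lintegral_ofReal h (Filter.Eventually.of_forall hF)).le
  · rw [integral_undef h]; simp

lemma lintegral_ofReal_le {α : Type*} [MeasurableSpace α] (ν : Measure α) (F H : α → ℝ) (c : ℝ)
    (hF : ∀ a, 0 ≤ F a) (hFH : ∀ a, F a ≤ H a) (hH : Integrable H ν) (hc : ∫ a, H a ∂ν ≤ c) :
    ∫⁻ a, ENNReal.ofReal (F a) ∂ν ≤ ENNReal.ofReal c := by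
  calc _ ≤ ∫⁻ a, ENNReal.ofReal (H a) ∂ν := lintegral_mono fun a => ENNReal.ofReal_le_ofReal (hFH a)
    _ = ENNReal.ofReal (∫ a, H a ∂ν) := (ofReal_integral_eq_lintegral_ofReal hH
        (Filter.Eventually.of_forall fun a => (hF a).trans (hFH a))).symm
    _ ≤ _ := ENNReal.ofReal_le_ofReal hc

lemma sum_lintegral_le {α ι : Type*} [MeasurableSpace α] (ν : Measure α) (s : Finset ι)
    (F : ι → α → ENNReal) : ∑ i ∈ s, ∫⁻ a, F i a ∂ν ≤ ∫⁻ a, ∑ i ∈ s, F i a ∂ν := by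
  classical
  induction s using Finset.induction_on with
  | empty => simp
  | insert i s hi ih =>
    simp only [Finset.sum_insert hi]
    exact (add_le_add le_rfl ih).trans (le_lintegral_add _ _)

set_option maxHeartbeats 400000 in
lemma step_bound (n m : ℕ)
    (f : Finset (Fin n) → EuclideanSpace ℝ (Fin m) → ℝ)
    (hconc : ∀ S : Finset (Fin n), ConcaveOn ℝ Set.univ (f S))
    (L0y : ℝ) (hL0y : 0 < L0y)
    (hlip : ∀ S : Finset (Fin n), ∀ y y' : EuclideanSpace ℝ (Fin m),
      |f S y - f S y'| ≤ L0y * ‖y - y'‖)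
    (Y : Set (EuclideanSpace ℝ (Fin m)))
    (hYconv : Convex ℝ Y)
    (xstar : EuclideanSpace ℝ (Fin n)) (ystar : EuclideanSpace ℝ (Fin m))
    (hxs : xstar ∈ hypercube n) (hys : ystar ∈ Y)
    (hsaddle : ∀ x ∈ hypercube n, ∀ y ∈ Y,
      lovasz f xstar y ≤ lovasz f xstar ystar ∧ lovasz f xstar ystar ≤ lovasz f x ystar)
    (g : EuclideanSpace ℝ (Fin n) → EuclideanSpace ℝ (Fin m) → EuclideanSpace ℝ (Fin n))
    (L0 : ℝ)
    (hg_sub : ∀ x ∈ hypercube n, ∀ y ∈ Y, ∀ x' ∈ hypercube n,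
      lovasz f x y + ⟪g x y, x' - x⟫ ≤ lovasz f x' y)
    (hg_bd : ∀ x ∈ hypercube n, ∀ y ∈ Y, ‖g x y‖ ≤ L0)
    (h1 h2 μ : ℝ) (hh1 : 0 < h1) (hh2 : 0 < h2) (hμ : 0 < μ)
    (x0 : EuclideanSpace ℝ (Fin n)) (y0 : EuclideanSpace ℝ (Fin m))
    (hx0 : x0 ∈ hypercube n) (hy0 : y0 ∈ Y)
    (xh x1 : EuclideanSpace ℝ (Fin m) × EuclideanSpace ℝ (Fin m) → EuclideanSpace ℝ (Fin n))
    (yh y1 : EuclideanSpace ℝ (Fin m) × EuclideanSpace ℝ (Fin m) → EuclideanSpace ℝ (Fin m))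
    (hp : ∀ w, IsProjOn (hypercube n) (x0 - h1 • g x0 y0) (xh w)
      ∧ IsProjOn Y (y0 + h1 • oracle f x0 y0 μ w.1) (yh w)
      ∧ IsProjOn (hypercube n) (x0 - h2 • g (xh w) (yh w)) (x1 w)
      ∧ IsProjOn Y (y0 + h2 • oracle f (xh w) (yh w) μ w.2) (y1 w)) (c : ℝ) (hc : 0 ≤ c) :
    ∫⁻ w, ENNReal.ofReal (2 * h2 * (lovasz f (xh w) ystar - lovasz f xstar (yh w))
        + (‖x1 w - xstar‖ ^ 2 + ‖y1 w - ystar‖ ^ 2 + c)) ∂((stdGaussian m).prod (stdGaussian m))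
      ≤ ENNReal.ofReal (‖x0 - xstar‖ ^ 2 + ‖y0 - ystar‖ ^ 2 + (c +
        2 * h2 * ((h2 / 2 + h1) * (L0 ^ 2 + L0y ^ 2 * ((m : ℝ) + 4) ^ 2) + μ * L0y * Real.sqrt m))) := by
  have hL0 : 0 ≤ L0 := (norm_nonneg _).trans (hg_bd x0 hx0 y0 hy0)
  set c2 : (𝔼 m) → ℝ := fun u => (‖x0 - xstar‖ ^ 2 + ‖y0 - ystar‖ ^ 2 + c + 2 * h2 * (μ * L0y * Real.sqrt m)
    + (h2 ^ 2 + 2 * h1 * h2) * L0 ^ 2 + (h2 ^ 2 + h1 * h2) * (L0y ^ 2 * ((m:ℝ) + 4) ^ 2))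
    + h1 * h2 * L0y ^ 2 * ‖u‖ ^ 4 with hc2
  have hR : ∀ w, 0 ≤ lovasz f (xh w) ystar - lovasz f xstar (yh w) := fun w => by
    obtain ⟨p1, p2, -, -⟩ := hp w
    have := hsaddle _ p1.1 _ p2.1
    linarith
  have inner_bound : ∀ u : 𝔼 m, ∫⁻ v, ENNReal.ofReal (2 * h2 * (lovasz f (xh (u, v)) ystar - lovasz f xstar (yh (u, v)))
        + (‖x1 (u, v) - xstar‖ ^ 2 + ‖y1 (u, v) - ystar‖ ^ 2 + c)) ∂(stdGaussian m) ≤ ENNReal.ofReal (c2 u) := by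
    intro u
    set p := xh (u, 0) with hpdef
    set q := yh (u, 0) with hqdef
    have exh : ∀ v, xh (u, v) = p := fun v => proj_unique (cube_convex n) (hp (u, v)).1 (hp (u, 0)).1
    have eyh : ∀ v, yh (u, v) = q := fun v => proj_unique hYconv (hp (u, v)).2.1 (hp (u, 0)).2.1
    have hpm : p ∈ hypercube n := (hp (u, 0)).1.1
    have hqm : q ∈ Y := (hp (u, 0)).2.1.1
    obtain ⟨K1, hK1⟩ : ∃ K1 : ℝ, K1 = 2 * h2 * (lovasz f p ystar - lovasz f xstar q) + ‖x0 - xstar‖ ^ 2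
      + 2 * h2 * ⟪g p q, xstar - p⟫ + (h2 ^ 2 + 2 * h1 * h2) * L0 ^ 2 + ‖y0 - ystar‖ ^ 2
      + h1 * h2 * L0y ^ 2 * ‖u‖ ^ 4 + c := ⟨_, rfl⟩
    have hOi : Integrable (fun v => ⟪oracle f p q μ v, q - ystar⟫) (stdGaussian m) := by
      refine ((gint_pow m 2).const_mul (L0y * ‖q - ystar‖)).mono' ?_ ?_
      · exact ((oracle_cont f L0y hL0y hlip p q μ).inner continuous_const).aestronglyMeasurable
      · refine Filter.Eventually.of_forall fun v => ?_
        refine (norm_inner_le_norm _ _).trans ?_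
        have := mul_le_mul_of_nonneg_right (oracle_norm f L0y hlip p q μ hμ v) (norm_nonneg (q - ystar))
        linarith
    have hOe : ∫ v, ⟪oracle f p q μ v, q - ystar⟫ ∂(stdGaussian m) ≤
        -(lovasz f p ystar - lovasz f p q - μ * L0y * Real.sqrt m) := by
      have := stein (lovasz f p) (lov_conc f hconc p) L0y hL0y (lov_lip f L0y hlip p) μ hμ q (ystar - q)
      rw [add_sub_cancel] at this
      have e : ∀ v, ⟪oracle f p q μ v, q - ystar⟫ =
          -((lovasz f p (q + μ • v) - lovasz f p q) / μ * ⟪v, ystar - q⟫) := fun v => by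
        unfold oracle
        rw [real_inner_smul_left, ← neg_sub ystar q, inner_neg_right]; ring
      simp only [e]
      rw [integral_neg]
      linarith
    have hi2 := hOi.const_mul (2 * h2)
    have hi4 := (gint_pow m 4).const_mul ((h2 ^ 2 + h1 * h2) * L0y ^ 2)
    have hi12 : Integrable (fun v => K1 + 2 * h2 * ⟪oracle f p q μ v, q - ystar⟫) (stdGaussian m) :=
      (integrable_const K1).add hi2
    have hall : Integrable (fun v => K1 + 2 * h2 * ⟪oracle f p q μ v, q - ystar⟫
      + (h2 ^ 2 + h1 * h2) * L0y ^ 2 * ‖v‖ ^ 4) (stdGaussian m) := Integrable.add hi12 hi4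
    refine lintegral_ofReal_le (stdGaussian m) _ (fun v => K1 + 2 * h2 * ⟪oracle f p q μ v, q - ystar⟫
      + (h2 ^ 2 + h1 * h2) * L0y ^ 2 * ‖v‖ ^ 4) (c2 u) ?_ ?_ hall ?_
    · intro v
      have := hR (u, v)
      positivity
    · intro v
      obtain ⟨p1, p2, p3, p4⟩ := hp (u, v)
      rw [exh, eyh] at p3 p4
      rw [exh] at p1
      rw [eyh] at p2
      simp only [exh, eyh]
      rw [sub_eq_add_neg, ← smul_neg] at p1 p3
      have A := eg_step (cube_convex n) hh1 hh2 hx0 hxs p1 p3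
      have B := eg_step hYconv hh1 hh2 hy0 hys p2 p4
      rw [norm_neg, norm_neg, inner_neg_left, ← inner_neg_right, neg_sub] at A
      have ga : ‖g x0 y0‖ ^ 2 ≤ L0 ^ 2 := pow_le_pow_left₀ (norm_nonneg _) (hg_bd _ hx0 _ hy0) 2
      have gb : ‖g p q‖ ^ 2 ≤ L0 ^ 2 := pow_le_pow_left₀ (norm_nonneg _) (hg_bd _ hpm _ hqm) 2
      have oa : ‖oracle f x0 y0 μ u‖ ^ 2 ≤ L0y ^ 2 * ‖u‖ ^ 4 := by
        refine (pow_le_pow_left₀ (norm_nonneg _) (oracle_norm f L0y hlip x0 y0 μ hμ u) 2).trans_eq ?_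
        ring
      have ob : ‖oracle f p q μ v‖ ^ 2 ≤ L0y ^ 2 * ‖v‖ ^ 4 := by
        refine (pow_le_pow_left₀ (norm_nonneg _) (oracle_norm f L0y hlip p q μ hμ v) 2).trans_eq ?_
        ring
      have c1 : (0:ℝ) ≤ h2 ^ 2 + h1 * h2 := by positivity
      have c2 : (0:ℝ) ≤ h1 * h2 := by positivity
      have ga' := mul_le_mul_of_nonneg_left ga c2
      have gb' := mul_le_mul_of_nonneg_left gb c1
      have oa' := mul_le_mul_of_nonneg_left oa c2
      have ob' := mul_le_mul_of_nonneg_left ob c1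
      simp only [] at A B
      rw [hK1]
      linarith
    · rw [integral_add hi12 hi4, integral_add (integrable_const K1) hi2, integral_const_mul, integral_const_mul]
      simp only [integral_const, probReal_univ, one_smul]
      have hg := hg_sub p hpm q hqm xstar hxs
      have m4 := mul_le_mul_of_nonneg_left (moment4 m)
        (by positivity : (0:ℝ) ≤ (h2 ^ 2 + h1 * h2) * L0y ^ 2)
      have o' := mul_le_mul_of_nonneg_left hOe (by positivity : (0:ℝ) ≤ 2 * h2)
      have g' := mul_le_mul_of_nonneg_left hg (by positivity : (0:ℝ) ≤ 2 * h2)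
      rw [hK1, hc2]
      simp only
      linarith
  refine (lintegral_prod_le _).trans ((lintegral_mono inner_bound).trans ?_)
  have hi4 := (gint_pow m 4).const_mul (h1 * h2 * L0y ^ 2)
  have hall : Integrable c2 (stdGaussian m) := Integrable.add (integrable_const _) hi4
  refine lintegral_ofReal_le _ _ c2 _ ?_ (fun _ => le_rfl) hall ?_
  · intro u; rw [hc2]; simp only; positivity
  · rw [hc2, integral_add (integrable_const _) hi4, integral_const_mul]
    simp only [integral_const, probReal_univ, one_smul]
    have m4 := mul_le_mul_of_nonneg_left (moment4 m)
        (by positivity : (0:ℝ) ≤ h1 * h2 * L0y ^ 2)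
    linarith

lemma main_ind (n m : ℕ)
    (f : Finset (Fin n) → EuclideanSpace ℝ (Fin m) → ℝ)
    (hconc : ∀ S : Finset (Fin n), ConcaveOn ℝ Set.univ (f S))
    (L0y : ℝ) (hL0y : 0 < L0y)
    (hlip : ∀ S : Finset (Fin n), ∀ y y' : EuclideanSpace ℝ (Fin m),
      |f S y - f S y'| ≤ L0y * ‖y - y'‖)
    (Y : Set (EuclideanSpace ℝ (Fin m)))
    (hYconv : Convex ℝ Y)
    (xstar : EuclideanSpace ℝ (Fin n)) (ystar : EuclideanSpace ℝ (Fin m))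
    (hxs : xstar ∈ hypercube n) (hys : ystar ∈ Y)
    (hsaddle : ∀ x ∈ hypercube n, ∀ y ∈ Y,
      lovasz f xstar y ≤ lovasz f xstar ystar ∧ lovasz f xstar ystar ≤ lovasz f x ystar)
    (g : EuclideanSpace ℝ (Fin n) → EuclideanSpace ℝ (Fin m) → EuclideanSpace ℝ (Fin n))
    (L0 : ℝ)
    (hg_sub : ∀ x ∈ hypercube n, ∀ y ∈ Y, ∀ x' ∈ hypercube n,
      lovasz f x y + ⟪g x y, x' - x⟫ ≤ lovasz f x' y)
    (hg_bd : ∀ x ∈ hypercube n, ∀ y ∈ Y, ‖g x y‖ ≤ L0)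
    (h1 h2 μ : ℝ) (hh1 : 0 < h1) (hh2 : 0 < h2) (hμ : 0 < μ) (T : ℕ) :
    ∀ (x0 : EuclideanSpace ℝ (Fin n)) (y0 : EuclideanSpace ℝ (Fin m))
    (_ : x0 ∈ hypercube n) (_ : y0 ∈ Y)
    (X Xh : ℕ → (Fin T → EuclideanSpace ℝ (Fin m) × EuclideanSpace ℝ (Fin m)) →
      EuclideanSpace ℝ (Fin n))
    (Yv Yh : ℕ → (Fin T → EuclideanSpace ℝ (Fin m) × EuclideanSpace ℝ (Fin m)) →
      EuclideanSpace ℝ (Fin m))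
    (_ : ∀ ω, X 0 ω = x0 ∧ Yv 0 ω = y0)
    (_ : ∀ k : Fin T, ∀ ω,
      IsProjOn (hypercube n) (X k ω - h1 • g (X k ω) (Yv k ω)) (Xh k ω)
      ∧ IsProjOn Y (Yv k ω + h1 • oracle f (X k ω) (Yv k ω) μ (ω k).1) (Yh k ω)
      ∧ IsProjOn (hypercube n) (X k ω - h2 • g (Xh k ω) (Yh k ω)) (X (k + 1) ω)
      ∧ IsProjOn Y (Yv k ω + h2 • oracle f (Xh k ω) (Yh k ω) μ (ω k).2) (Yv (k + 1) ω)),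
    ∫⁻ ω, ∑ k ∈ Finset.range T, ENNReal.ofReal (2 * h2 * (lovasz f (Xh k ω) ystar - lovasz f xstar (Yh k ω)))
          ∂(Measure.pi fun _ : Fin T => (stdGaussian m).prod (stdGaussian m))
      ≤ ENNReal.ofReal (‖x0 - xstar‖ ^ 2 + ‖y0 - ystar‖ ^ 2 + T *
        (2 * h2 * ((h2 / 2 + h1) * (L0 ^ 2 + L0y ^ 2 * ((m : ℝ) + 4) ^ 2) + μ * L0y * Real.sqrt m))) := by
  set Cst := 2 * h2 * ((h2 / 2 + h1) * (L0 ^ 2 + L0y ^ 2 * ((m : ℝ) + 4) ^ 2) + μ * L0y * Real.sqrt m) with hCst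
  have hCst0 : 0 ≤ Cst := by positivity
  induction T with
  | zero => intros; simp
  | succ T ih =>
    intro x0 y0 hx0 hy0 X Xh Yv Yh hinit hstep
    set γ := (stdGaussian m).prod (stdGaussian m) with hγ
    have mp := (measurePreserving_piFinSuccAbove (fun _ : Fin (T + 1) => γ) 0).symm
    rw [← mp.lintegral_comp_emb (MeasurableEquiv.measurableEmbedding _)]
    have econs : ∀ w : ((𝔼 m) × (𝔼 m)) × (Fin T → (𝔼 m) × (𝔼 m)),
        (MeasurableEquiv.piFinSuccAbove (fun _ : Fin (T + 1) => (𝔼 m) × (𝔼 m)) 0).symm w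
          = (Fin.cons w.1 w.2 : Fin (T + 1) → (𝔼 m) × (𝔼 m)) := by
      intro w
      simp [MeasurableEquiv.piFinSuccAbove, Fin.insertNthEquiv]
    simp only [econs]
    set cn : ((𝔼 m) × (𝔼 m)) → (Fin T → (𝔼 m) × (𝔼 m)) → (Fin (T + 1) → (𝔼 m) × (𝔼 m)) :=
      fun w ω => Fin.cons w ω with hcn
    have h0 : ∀ w ω, IsProjOn (hypercube n) (x0 - h1 • g x0 y0) (Xh 0 (cn w ω))
      ∧ IsProjOn Y (y0 + h1 • oracle f x0 y0 μ w.1) (Yh 0 (cn w ω))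
      ∧ IsProjOn (hypercube n) (x0 - h2 • g (Xh 0 (cn w ω)) (Yh 0 (cn w ω))) (X 1 (cn w ω))
      ∧ IsProjOn Y (y0 + h2 • oracle f (Xh 0 (cn w ω)) (Yh 0 (cn w ω)) μ w.2) (Yv 1 (cn w ω)) := by
      intro w ω
      have := hstep 0 (cn w ω)
      simp only [Fin.val_zero, (hinit _).1, (hinit _).2, zero_add] at this
      simpa [hcn] using this
    have exh : ∀ w ω, Xh 0 (cn w ω) = Xh 0 (cn w 0) := fun w ω =>
      proj_unique (cube_convex n) (h0 w ω).1 (h0 w 0).1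
    have eyh : ∀ w ω, Yh 0 (cn w ω) = Yh 0 (cn w 0) := fun w ω =>
      proj_unique hYconv (h0 w ω).2.1 (h0 w 0).2.1
    have ex1 : ∀ w ω, X 1 (cn w ω) = X 1 (cn w 0) := fun w ω => by
      have a := (h0 w ω).2.2.1
      rw [exh, eyh] at a
      exact proj_unique (cube_convex n) a (h0 w 0).2.2.1
    have ey1 : ∀ w ω, Yv 1 (cn w ω) = Yv 1 (cn w 0) := fun w ω => by
      have a := (h0 w ω).2.2.2
      rw [exh, eyh] at a
      exact proj_unique hYconv a (h0 w 0).2.2.2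
    have hinner : ∀ w, ∫⁻ ω, ∑ k ∈ Finset.range (T + 1), ENNReal.ofReal (2 * h2 *
        (lovasz f (Xh k (cn w ω)) ystar - lovasz f xstar (Yh k (cn w ω)))) ∂(Measure.pi fun _ : Fin T => γ)
        ≤ ENNReal.ofReal (2 * h2 * (lovasz f (Xh 0 (cn w 0)) ystar - lovasz f xstar (Yh 0 (cn w 0)))
        + (‖X 1 (cn w 0) - xstar‖ ^ 2 + ‖Yv 1 (cn w 0) - ystar‖ ^ 2 + T * Cst)) := by
      intro w
      have hR : 0 ≤ lovasz f (Xh 0 (cn w 0)) ystar - lovasz f xstar (Yh 0 (cn w 0)) := by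
        have := hsaddle _ (h0 w 0).1.1 _ (h0 w 0).2.1.1
        linarith
      have hih := ih (X 1 (cn w 0)) (Yv 1 (cn w 0)) (h0 w 0).2.2.1.1 (h0 w 0).2.2.2.1
        (fun k ω => X (k + 1) (cn w ω)) (fun k ω => Xh (k + 1) (cn w ω))
        (fun k ω => Yv (k + 1) (cn w ω)) (fun k ω => Yh (k + 1) (cn w ω))
        (fun ω => ⟨ex1 w ω, ey1 w ω⟩) (fun k ω => by
          have := hstep k.succ (cn w ω)
          simpa [hcn, Fin.val_succ] using this)
      simp only [Finset.sum_range_succ', exh, eyh]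
      rw [lintegral_add_right _ measurable_const, lintegral_const, measure_univ, mul_one, add_comm,
        ENNReal.ofReal_add (by positivity) (by positivity)]
      exact add_le_add le_rfl hih
    refine (lintegral_prod_le _).trans ((lintegral_mono hinner).trans ?_)
    refine (step_bound n m f hconc L0y hL0y hlip Y hYconv xstar ystar hxs hys hsaddle g L0 hg_sub hg_bd
      h1 h2 μ hh1 hh2 hμ x0 y0 hx0 hy0 (fun w => Xh 0 (cn w 0)) (fun w => X 1 (cn w 0))
      (fun w => Yh 0 (cn w 0)) (fun w => Yv 1 (cn w 0)) (fun w => h0 w 0) (T * Cst) (by positivity)).trans ?_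
    refine ENNReal.ofReal_le_ofReal (le_of_eq ?_)
    rw [← hCst]; push_cast; ring

end ZO

/-- ZO-EG, offline restricted-gap bound: for `f` submodular in its first variable
and concave and `L_{0y}`-Lipschitz in its second variable, with Lovász extension
`f^L` having saddle point `z* = (x*,y*)` on `Z = [0,1]^n × Y`, subgradients
bounded by `L₀`, constant step sizes `h₁, h₂ > 0`, smoothing parameter `μ > 0`
and initial point `z₀ ∈ Z`, the iterates `ẑ_k = (x̂_k, ŷ_k)` satisfy
`(1/(N+1)) Σ_{k=0}^N E[R^L(ẑ_k)] ≤ r₀²/(2h₂(N+1))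
+ (h₂/2 + h₁)(L₀² + L_{0y}²(m+4)²) + μ L_{0y} √m` with `r₀ = ‖z₀ − z*‖`. -/
theorem zoeg_offline_restricted_gap (n m N : ℕ)
    (f : Finset (Fin n) → EuclideanSpace ℝ (Fin m) → ℝ)
    (hsub : ∀ y, ∀ S T : Finset (Fin n), f (S ∩ T) y + f (S ∪ T) y ≤ f S y + f T y)
    (hconc : ∀ S : Finset (Fin n), ConcaveOn ℝ Set.univ (f S))
    (L0y : ℝ) (hL0y : 0 < L0y)
    (hlip : ∀ S : Finset (Fin n), ∀ y y' : EuclideanSpace ℝ (Fin m),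
      |f S y - f S y'| ≤ L0y * ‖y - y'‖)
    (Y : Set (EuclideanSpace ℝ (Fin m))) (hY : Y.Nonempty)
    (hYconv : Convex ℝ Y) (hYc : IsCompact Y)
    (xstar : EuclideanSpace ℝ (Fin n)) (ystar : EuclideanSpace ℝ (Fin m))
    (hxs : xstar ∈ hypercube n) (hys : ystar ∈ Y)
    (hsaddle : ∀ x ∈ hypercube n, ∀ y ∈ Y,
      lovasz f xstar y ≤ lovasz f xstar ystar ∧ lovasz f xstar ystar ≤ lovasz f x ystar)
    (g : EuclideanSpace ℝ (Fin n) → EuclideanSpace ℝ (Fin m) → EuclideanSpace ℝ (Fin n))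
    (L0 : ℝ)
    (hg_sub : ∀ x ∈ hypercube n, ∀ y ∈ Y, ∀ x' ∈ hypercube n,
      lovasz f x y + ⟪g x y, x' - x⟫ ≤ lovasz f x' y)
    (hg_bd : ∀ x ∈ hypercube n, ∀ y ∈ Y, ‖g x y‖ ≤ L0)
    (h1 h2 μ : ℝ) (hh1 : 0 < h1) (hh2 : 0 < h2) (hμ : 0 < μ)
    (x0 : EuclideanSpace ℝ (Fin n)) (y0 : EuclideanSpace ℝ (Fin m))
    (hx0 : x0 ∈ hypercube n) (hy0 : y0 ∈ Y)
    -- the iterates, as functions of the sequence of Gaussian sample pairs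
    (X Xh : ℕ → (Fin (N + 1) → EuclideanSpace ℝ (Fin m) × EuclideanSpace ℝ (Fin m)) →
      EuclideanSpace ℝ (Fin n))
    (Yv Yh : ℕ → (Fin (N + 1) → EuclideanSpace ℝ (Fin m) × EuclideanSpace ℝ (Fin m)) →
      EuclideanSpace ℝ (Fin m))
    (hinit : ∀ ω, X 0 ω = x0 ∧ Yv 0 ω = y0)
    (hstep : ∀ k : Fin (N + 1), ∀ ω,
      IsProjOn (hypercube n) (X k ω - h1 • g (X k ω) (Yv k ω)) (Xh k ω)
      ∧ IsProjOn Y (Yv k ω + h1 • oracle f (X k ω) (Yv k ω) μ (ω k).1) (Yh k ω)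
      ∧ IsProjOn (hypercube n) (X k ω - h2 • g (Xh k ω) (Yh k ω)) (X (k + 1) ω)
      ∧ IsProjOn Y (Yv k ω + h2 • oracle f (Xh k ω) (Yh k ω) μ (ω k).2) (Yv (k + 1) ω)) :
    (1 / ((N : ℝ) + 1)) * ∑ k ∈ Finset.range (N + 1),
        ∫ ω, (lovasz f (Xh k ω) ystar - lovasz f xstar (Yh k ω))
          ∂(Measure.pi fun _ : Fin (N + 1) => (stdGaussian m).prod (stdGaussian m))
      ≤ (‖x0 - xstar‖ ^ 2 + ‖y0 - ystar‖ ^ 2) / (2 * h2 * ((N : ℝ) + 1))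
        + (h2 / 2 + h1) * (L0 ^ 2 + L0y ^ 2 * ((m : ℝ) + 4) ^ 2)
        + μ * L0y * Real.sqrt m := by
  have hind := ZO.main_ind n m f hconc L0y hL0y hlip Y hYconv xstar ystar hxs hys hsaddle g L0 hg_sub hg_bd
    h1 h2 μ hh1 hh2 hμ (N + 1) x0 y0 hx0 hy0 X Xh Yv Yh hinit hstep
  set P := (Measure.pi fun _ : Fin (N + 1) => (stdGaussian m).prod (stdGaussian m)) with hP
  set B := (h2 / 2 + h1) * (L0 ^ 2 + L0y ^ 2 * ((m : ℝ) + 4) ^ 2) + μ * L0y * Real.sqrt m with hB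
  have hB0 : 0 ≤ B := by positivity
  have hR : ∀ k ∈ Finset.range (N + 1), ∀ ω, 0 ≤ lovasz f (Xh k ω) ystar - lovasz f xstar (Yh k ω) := by
    intro k hk ω
    have hs := hstep ⟨k, Finset.mem_range.1 hk⟩ ω
    have := hsaddle _ hs.1.1 _ hs.2.1.1
    simp only at this
    linarith
  have hsum : ENNReal.ofReal (∑ k ∈ Finset.range (N + 1),
      ∫ ω, 2 * h2 * (lovasz f (Xh k ω) ystar - lovasz f xstar (Yh k ω)) ∂P) ≤
      ENNReal.ofReal (‖x0 - xstar‖ ^ 2 + ‖y0 - ystar‖ ^ 2 + ((N + 1 : ℕ) : ℝ) * (2 * h2 * B)) := by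
    rw [ENNReal.ofReal_sum_of_nonneg (fun k hk => integral_nonneg fun ω =>
      mul_nonneg (by positivity) (hR k hk ω))]
    refine le_trans ?_ hind
    refine le_trans ?_ (ZO.sum_lintegral_le _ _ _)
    exact Finset.sum_le_sum fun k hk => ZO.ofReal_integral_le _ _ fun ω =>
      mul_nonneg (by positivity) (hR k hk ω)
  rw [ENNReal.ofReal_le_ofReal_iff (by positivity)] at hsum
  simp only [integral_const_mul] at hsum
  rw [← Finset.mul_sum] at hsum
  set S := ∑ k ∈ Finset.range (N + 1),
      ∫ ω, (lovasz f (Xh k ω) ystar - lovasz f xstar (Yh k ω)) ∂P with hS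
  have hN : (0:ℝ) < (N:ℝ) + 1 := by positivity
  push_cast at hsum
  rw [add_assoc, ← hB, one_div, inv_mul_le_iff₀ hN]
  have e : ((N:ℝ) + 1) * ((‖x0 - xstar‖ ^ 2 + ‖y0 - ystar‖ ^ 2) / (2 * h2 * ((N : ℝ) + 1)) + B)
      = (‖x0 - xstar‖ ^ 2 + ‖y0 - ystar‖ ^ 2 + ((N:ℝ) + 1) * (2 * h2 * B)) / (2 * h2) := by
    field_simp
  rw [e, le_div_iff₀ (by positivity)]
  linarith
end
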